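/- arXiv:0811.4079 — 3 statements merged into one kernel-verified Lean document; each statement's English description precedes it below -/
import Mathlib

section
/- Let d = 1. For x ≥ 0 define T_x = inf{t ≥ 0 : X_t = x and X_s > 0 for all s ∈ (t, t+1]} and the shifted path map φ_x : C_∞ → C_∞, φ_x(w)(s) = w(T_x(w) + s). Then for every x > 0, the conditioned law equals the unconditioned image law: W̃^+_{x,1} = W_0 ∘ φ_x^{-1}. -/
open MeasureTheory ProbabilityTheory Filter Topology NNReal ENNReal

noncomputable section

abbrev Path1 : Type := C(ℝ≥0, ℝ)

instance : MeasurableSpace Path1 := borel _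
instance : BorelSpace Path1 := ⟨rfl⟩

/-- `W` is the family of laws of standard one-dimensional Brownian motion: `W x` is a
probability measure on path space, starting a.s. at `x`, with independent centered
Gaussian increments of the right variances. -/
def IsWiener1 (W : ℝ → Measure Path1) : Prop :=
  ∀ x : ℝ, IsProbabilityMeasure (W x) ∧ (W x) {w | w 0 = x} = 1 ∧
    ∀ (n : ℕ) (t : Fin (n + 1) → ℝ≥0), Monotone t →
      (W x).map (fun w (i : Fin n) => w (t i.succ) - w (t i.castSucc))
        = Measure.pi (fun i : Fin n => gaussianReal 0 (t i.succ - t i.castSucc))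

/-- `τ_+ = inf {t > 0 : X_t ≤ 0}`, the first exit time from `(0, ∞)`. -/
def exitTimePos (w : Path1) : ℝ≥0∞ :=
  sInf (((↑) : ℝ≥0 → ℝ≥0∞) '' {t : ℝ≥0 | 0 < t ∧ w t ≤ 0})

/-- `W̃^+_{x,1} = W_x(· | τ_+ > 1)`: Brownian motion started at `x` conditioned to stay
positive for a unit of time. -/
def condPos (W : ℝ → Measure Path1) (x : ℝ) : Measure Path1 :=
  ProbabilityTheory.cond (W x) {w | 1 < exitTimePos w}


/-- `T_x = inf {t ≥ 0 : X_t = x and X_s > 0 for all s ∈ (t, t+1]}` (with value `∞` if no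
such time exists). -/
def hitStay (x : ℝ) (w : Path1) : ℝ≥0∞ :=
  sInf (((↑) : ℝ≥0 → ℝ≥0∞) ''
    {t : ℝ≥0 | w t = x ∧ ∀ s : ℝ≥0, t < s → s ≤ t + 1 → 0 < w s})

/-- The section map `φ_x(w)(s) = w(T_x(w) + s)`. -/
def sectionMap (x : ℝ) (w : Path1) : Path1 :=
  ⟨fun s => w ((hitStay x w).toNNReal + s), by fun_prop⟩

section PathSpace

/-- Shift of a path by time `t`. -/
def shiftPath (t : ℝ≥0) (w : Path1) : Path1 := ⟨fun s => w (t + s), by fun_prop⟩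

/-- The path stopped at time `t`. -/
def stopPath (t : ℝ≥0) (w : Path1) : Path1 := ⟨fun s => w (min s t), by fun_prop⟩

/-- The path after time `t`, recentred to start at `0`. -/
def incrPath (t : ℝ≥0) (w : Path1) : Path1 := ⟨fun s => w (t + s) - w t, by fun_prop⟩

/-- Vertical translation of a path. -/
def translatePath (a : ℝ) (w : Path1) : Path1 := ⟨fun s => w s + a, by fun_prop⟩

@[simp] lemma shiftPath_apply (t s : ℝ≥0) (w : Path1) : shiftPath t w s = w (t + s) := rfl
@[simp] lemma stopPath_apply (t s : ℝ≥0) (w : Path1) : stopPath t w s = w (min s t) := rfl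
@[simp] lemma incrPath_apply (t s : ℝ≥0) (w : Path1) : incrPath t w s = w (t + s) - w t := rfl
@[simp] lemma translatePath_apply (a : ℝ) (s : ℝ≥0) (w : Path1) :
    translatePath a w s = w s + a := rfl

lemma continuous_shiftPath : Continuous fun p : ℝ≥0 × Path1 => shiftPath p.1 p.2 :=
  ContinuousMap.continuous_of_continuous_uncurry _
    (by simp only [Function.uncurry_def, shiftPath_apply]; fun_prop)

lemma continuous_incrPath : Continuous fun p : ℝ≥0 × Path1 => incrPath p.1 p.2 :=
  ContinuousMap.continuous_of_continuous_uncurry _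
    (by simp only [Function.uncurry_def, incrPath_apply]; fun_prop)

lemma continuous_translatePath (a : ℝ) : Continuous (translatePath a) :=
  ContinuousMap.continuous_of_continuous_uncurry _
    (by simp only [Function.uncurry_def, translatePath_apply]; fun_prop)

lemma measurable_path_eval : Measurable fun (w : Path1) (t : ℝ≥0) => w t :=
  measurable_pi_lambda _ fun t => (continuous_eval_const t).measurable

/-- The Borel σ-algebra of path space is generated by the coordinate maps. -/
lemma path_measurableSpace_eq :
    (inferInstance : MeasurableSpace Path1) =
      MeasurableSpace.comap (fun (w : Path1) (t : ℝ≥0) => w t) MeasurableSpace.pi := by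
  apply le_antisymm
  · have hc : Continuous fun (w : Path1) (n : ℕ) => w (TopologicalSpace.denseSeq ℝ≥0 n) := by
      fun_prop
    have hinj : Function.Injective
        fun (w : Path1) (n : ℕ) => w (TopologicalSpace.denseSeq ℝ≥0 n) := by
      intro v w h
      apply DFunLike.coe_injective
      refine Continuous.ext_on (TopologicalSpace.denseRange_denseSeq ℝ≥0)
        v.continuous w.continuous ?_
      rintro _ ⟨n, rfl⟩
      exact congrFun h n
    rw [← (hc.measurableEmbedding hinj).comap_eq]
    have : (fun (w : Path1) (n : ℕ) => w (TopologicalSpace.denseSeq ℝ≥0 n))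
        = (fun (f : ℝ≥0 → ℝ) (n : ℕ) => f (TopologicalSpace.denseSeq ℝ≥0 n)) ∘
          fun (w : Path1) (t : ℝ≥0) => w t := rfl
    rw [this, ← MeasurableSpace.comap_comp]
    refine MeasurableSpace.comap_mono ?_
    exact (measurable_pi_lambda _ fun n => measurable_pi_apply _).comap_le
  · exact measurable_path_eval.comap_le

lemma indepFun_path_left {Ω E : Type*} {mΩ : MeasurableSpace Ω} {mE : MeasurableSpace E}
    {P : Measure Ω} {Z : Ω → Path1} {Y : Ω → E}
    (h : IndepFun (fun ω (t : ℝ≥0) => Z ω t) Y P) : IndepFun Z Y P := by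
  rw [IndepFun_iff_Indep] at h ⊢
  have e : MeasurableSpace.comap Z inferInstance
      = MeasurableSpace.comap (fun ω (t : ℝ≥0) => Z ω t) MeasurableSpace.pi := by
    rw [path_measurableSpace_eq, MeasurableSpace.comap_comp]; rfl
  rwa [e]

/-- Two path-valued random variables that are pre-Brownian have the same law. -/
lemma map_eq_of_isPreBrownianReal {Ω Ω' : Type*} {mΩ : MeasurableSpace Ω}
    {mΩ' : MeasurableSpace Ω'} {P : Measure Ω} {P' : Measure Ω'}
    {Z : Ω → Path1} {Z' : Ω' → Path1} (hZm : Measurable Z) (hZm' : Measurable Z')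
    (hZ : IsPreBrownianReal (fun t ω => Z ω t) P)
    (hZ' : IsPreBrownianReal (fun t ω => Z' ω t) P') :
    P.map Z = P'.map Z' := by
  have h1 := isProjectiveLimit_map (measurable_path_eval.comp hZm).aemeasurable (P := P)
  have h2 := isProjectiveLimit_map (measurable_path_eval.comp hZm').aemeasurable (P := P')
  have e1 : (fun I : Finset ℝ≥0 => P.map fun ω => I.restrict fun t => Z ω t)
      = fun I => P'.map fun ω => I.restrict fun t => Z' ω t := by
    funext I
    exact (hZ.hasLaw I).map_eq.trans (hZ'.hasLaw I).map_eq.symm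
  have hfin : ∀ I : Finset ℝ≥0,
      IsFiniteMeasure (P'.map fun ω => I.restrict fun t => Z' ω t) := fun I => by
    rw [(hZ'.hasLaw I).map_eq]; infer_instance
  have key : P.map (fun ω (t : ℝ≥0) => Z ω t) = P'.map (fun ω (t : ℝ≥0) => Z' ω t) := by
    refine IsProjectiveLimit.unique (P := fun I => P'.map fun ω => I.restrict fun t => Z' ω t)
      ?_ h2
    rw [← e1]; exact h1
  ext A hA
  obtain ⟨B, hB, rfl⟩ := path_measurableSpace_eq.le A hA
  have := congrArg (fun μ => μ B) key
  have m1 : Measurable fun ω (t : ℝ≥0) => Z ω t := measurable_path_eval.comp hZm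
  have m2 : Measurable fun ω (t : ℝ≥0) => Z' ω t := measurable_path_eval.comp hZm'
  rw [Measure.map_apply m1 hB, Measure.map_apply m2 hB] at this
  rw [Measure.map_apply hZm hA, Measure.map_apply hZm' hA]
  exact this

end PathSpace

section Wiener

variable {W : ℝ → Measure Path1}

lemma IsWiener1.isProbabilityMeasure (hW : IsWiener1 W) (y : ℝ) :
    IsProbabilityMeasure (W y) := (hW y).1

lemma IsWiener1.ae_start (hW : IsWiener1 W) (y : ℝ) : ∀ᵐ w ∂(W y), w 0 = y := by
  have := (hW y).1
  have hm : MeasurableSet {w : Path1 | w 0 = y} :=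
    (isClosed_eq (by fun_prop) continuous_const).measurableSet
  exact (prob_compl_eq_zero_iff hm).2 (hW y).2.1

lemma IsWiener1.hasLaw_increments (hW : IsWiener1 W) (y : ℝ) (n : ℕ) (t : Fin (n + 1) → ℝ≥0)
    (ht : Monotone t) :
    HasLaw (fun (w : Path1) (i : Fin n) => w (t i.succ) - w (t i.castSucc))
      (Measure.pi fun i : Fin n => gaussianReal 0 (t i.succ - t i.castSucc)) (W y) :=
  ⟨by fun_prop, (hW y).2.2 n t ht⟩

lemma IsWiener1.isPreBrownianReal (hW : IsWiener1 W) (y : ℝ) :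
    IsPreBrownianReal (fun t (w : Path1) => w t - y) (W y) := by
  have := (hW y).1
  refine HasIndepIncrements.isPreBrownianReal_of_hasLaw (fun t => ?_) fun n t ht => ?_
  · have h := hW.hasLaw_increments y 1 ![0, t] (by
      intro i j hij; fin_cases i <;> fin_cases j <;> simp at hij ⊢)
    have h' := (measurePreserving_eval
      (fun i : Fin 1 => gaussianReal 0 ((![0, t] : Fin 2 → ℝ≥0) i.succ - ![0, t] i.castSucc))
      0).hasLaw.comp h
    simp only [Fin.isValue, Fin.succ_zero_eq_one, Fin.castSucc_zero,
      Matrix.cons_val_one, Matrix.cons_val_zero, tsub_zero, Matrix.cons_val_fin_one] at h'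
    refine h'.congr ?_
    filter_upwards [hW.ae_start y] with w hw
    simp [hw]
  · have h := hW.hasLaw_increments y n t ht
    simp only [sub_sub_sub_cancel_right]
    refine (iIndepFun_iff_hasLaw_pi_pi (fun i => ?_)).2 h
    exact (measurePreserving_eval (fun i : Fin n => gaussianReal 0 (t i.succ - t i.castSucc))
      i).hasLaw.comp h

lemma IsWiener1.eq_map_translatePath (hW : IsWiener1 W) (y : ℝ) :
    W y = (W 0).map (translatePath y) := by
  have h := map_eq_of_isPreBrownianReal (Z := translatePath (-y)) (Z' := id) (P := W y)
    (P' := W 0) (continuous_translatePath _).measurable measurable_id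
    (by simpa [sub_eq_add_neg] using hW.isPreBrownianReal y)
    (by simpa using hW.isPreBrownianReal 0)
  rw [Measure.map_id] at h
  rw [← h, Measure.map_map (continuous_translatePath _).measurable
    (continuous_translatePath _).measurable]
  convert Measure.map_id.symm using 2
  ext w s
  simp

lemma IsWiener1.map_incrPath (hW : IsWiener1 W) (y : ℝ) (t : ℝ≥0) :
    (W y).map (incrPath t) = W 0 := by
  have h := map_eq_of_isPreBrownianReal (Z := incrPath t) (Z' := id) (P := W y)
    (P' := W 0) (by have := continuous_incrPath; fun_prop) measurable_id
    (by simpa using (hW.isPreBrownianReal y).shift t)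
    (by simpa using hW.isPreBrownianReal 0)
  rwa [Measure.map_id] at h

lemma measurable_incrPath (t : ℝ≥0) : Measurable (incrPath t) :=
  (continuous_incrPath.comp (by fun_prop : Continuous fun w : Path1 => (t, w))).measurable

/-- The simple Markov property. -/
lemma IsWiener1.measure_inter_incrPath (hW : IsWiener1 W) (y : ℝ) (t : ℝ≥0) {A B : Set Path1}
    (hA : MeasurableSet A) (hAt : ∀ w, stopPath t w ∈ A ↔ w ∈ A) (hB : MeasurableSet B) :
    W y (A ∩ incrPath t ⁻¹' B) = W y A * W 0 B := by
  have hind : IndepFun (incrPath t) (stopPath t) (W y) := by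
    refine indepFun_path_left (IndepFun.symm (indepFun_path_left (IndepFun.symm ?_)))
    have h := (hW.isPreBrownianReal y).indepFun_shift t
    have h2 := h.comp (φ := id)
      (ψ := fun (f : Set.Iic t → ℝ) (s : ℝ≥0) => f ⟨min s t, Set.mem_Iic.2 (min_le_right s t)⟩ + y)
      measurable_id (measurable_pi_lambda _ fun s => Measurable.add_const
        (f := fun f : Set.Iic t → ℝ => f ⟨min s t, Set.mem_Iic.2 (min_le_right s t)⟩)
        (measurable_pi_apply _) y)
    convert h2 using 1
    · ext w s; simp
    · ext w s; simp
  have := hind.measure_inter_preimage_eq_mul B A hB hA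
  have e : stopPath t ⁻¹' A = A := by ext w; exact hAt w
  rw [e, Set.inter_comm, ← Measure.map_apply (measurable_incrPath t) hB, hW.map_incrPath,
    mul_comm] at this
  exact this

end Wiener

section StrongMarkov

variable {W : ℝ → Measure Path1}

/-- `τ` is a stopping time of the canonical filtration: whether `τ ≤ t` can be decided from the
path stopped at time `t`. -/
structure IsPathStopping (τ : Path1 → ℝ≥0∞) : Prop where
  measurable : Measurable τ
  stop_le_iff : ∀ (t : ℝ≥0) (w : Path1), τ (stopPath t w) ≤ t ↔ τ w ≤ t

lemma stopPath_stopPath {s t : ℝ≥0} (h : s ≤ t) (w : Path1) :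
    stopPath s (stopPath t w) = stopPath s w := by
  ext u
  simp only [stopPath_apply]
  congr 1
  exact min_eq_left ((min_le_right _ _).trans h)

lemma IsPathStopping.le_iff_of_le {τ : Path1 → ℝ≥0∞} (hτ : IsPathStopping τ) {s t : ℝ≥0}
    (h : s ≤ t) (w : Path1) : τ (stopPath t w) ≤ s ↔ τ w ≤ s := by
  rw [← hτ.stop_le_iff s, stopPath_stopPath h, hτ.stop_le_iff]

/-- The strong Markov property for the approximations of a stopping time from above by multiples
of `1 / (n + 1)`. -/
lemma IsWiener1.map_incrPath_ceil (hW : IsWiener1 W) (y : ℝ) {τ : Path1 → ℝ≥0∞}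
    (hτ : IsPathStopping τ) (c : ℝ≥0) (n : ℕ) :
    ((W y).restrict {w | τ w ≤ c}).map
        (fun w => incrPath ((⌈(n + 1) * (τ w).toNNReal⌉₊ : ℝ≥0) / (n + 1)) w)
      = W y {w | τ w ≤ c} • W 0 := by
  have hAm : MeasurableSet {w | τ w ≤ c} := measurableSet_le hτ.measurable measurable_const
  have hN : Measurable fun w => ⌈(n + 1) * (τ w).toNNReal⌉₊ :=
    Nat.measurable_ceil.comp ((hτ.measurable.ennreal_toNNReal).const_mul _)
  have hm : Measurable fun w => incrPath ((⌈(n + 1) * (τ w).toNNReal⌉₊ : ℝ≥0) / (n + 1)) w := by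
    refine continuous_incrPath.measurable.comp (Measurable.prodMk ?_ measurable_id)
    exact ((measurable_from_top (f := fun k : ℕ => (k : ℝ≥0))).comp hN).div_const _
  set D : ℕ → Set Path1 := fun k =>
    {w | τ w ≤ c} ∩ {w | ⌈(n + 1) * (τ w).toNNReal⌉₊ = k} with hD
  have hDm : ∀ k, MeasurableSet (D k) := fun k => hAm.inter (hN (measurableSet_singleton k))
  have hDd : Pairwise (Function.onFun Disjoint D) := by
    intro i j hij
    refine Set.disjoint_left.2 fun w hi hj => hij ?_
    exact hi.2.symm.trans hj.2
  have hDU : ⋃ k, D k = {w | τ w ≤ c} := by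
    ext w; simp [hD]
  have hDt : ∀ k w, stopPath ((k : ℝ≥0) / (n + 1)) w ∈ D k ↔ w ∈ D k := by
    intro k w
    have hpos : (0 : ℝ≥0) < n + 1 := by positivity
    have hle : ∀ (v : Path1) (j : ℕ), τ v ≤ c →
        (⌈(n + 1) * (τ v).toNNReal⌉₊ ≤ j ↔ τ v ≤ ((j : ℝ≥0) / (n + 1) : ℝ≥0)) := by
      intro v j hv
      rw [Nat.ceil_le, ← le_div_iff₀' hpos, ← ENNReal.coe_le_coe,
        ENNReal.coe_toNNReal (ne_top_of_le_ne_top coe_ne_top hv)]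
    have hmem : ∀ v, v ∈ D k ↔ τ v ≤ (min c ((k : ℝ≥0) / (n + 1)) : ℝ≥0) ∧
        ∀ j < k, ¬ τ v ≤ ((j : ℝ≥0) / (n + 1) : ℝ≥0) := by
      intro v
      rw [ENNReal.coe_min, le_min_iff, and_assoc]
      refine and_congr_right fun hv => ?_
      rw [Set.mem_ofPred_eq, ← hle v k hv]
      constructor
      · rintro rfl
        exact ⟨le_rfl, fun j hj h => hj.not_ge ((hle v j hv).2 h)⟩
      · rintro ⟨h1, h2⟩
        exact h1.antisymm (not_lt.1 fun h => h2 _ h ((hle v _ hv).1 le_rfl))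
    rw [hmem, hmem, hτ.le_iff_of_le (min_le_right _ _)]
    refine and_congr_right fun _ => forall₂_congr fun j hj => not_congr (hτ.le_iff_of_le ?_ w)
    gcongr
  ext B hB
  rw [Measure.map_apply hm hB, Measure.restrict_apply (hm hB), Measure.smul_apply, smul_eq_mul]
  have e : (fun w => incrPath ((⌈(n + 1) * (τ w).toNNReal⌉₊ : ℝ≥0) / (n + 1)) w) ⁻¹' B
      ∩ {w | τ w ≤ c} = ⋃ k : ℕ, D k ∩ incrPath ((k : ℝ≥0) / (n + 1)) ⁻¹' B := by
    ext w
    simp only [hD, Set.mem_inter_iff, Set.mem_preimage, Set.mem_iUnion, Set.mem_ofPred_eq]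
    constructor
    · rintro ⟨h1, h2⟩
      exact ⟨_, ⟨h2, rfl⟩, h1⟩
    · rintro ⟨k, ⟨h2, rfl⟩, h1⟩
      exact ⟨h1, h2⟩
  rw [e, measure_iUnion (fun i j hij => (hDd hij).mono Set.inter_subset_left Set.inter_subset_left)
    (fun k => (hDm k).inter (measurable_incrPath _ hB))]
  simp_rw [hW.measure_inter_incrPath y _ (hDm _) (hDt _) hB]
  rw [ENNReal.tsum_mul_right, ← measure_iUnion hDd hDm, hDU]

lemma tendsto_ceil_mul_div (r : ℝ≥0) :
    Tendsto (fun n : ℕ => (⌈(n + 1) * r⌉₊ : ℝ≥0) / (n + 1)) atTop (𝓝 r) := by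
  rw [← NNReal.tendsto_coe]
  have h := (tendsto_nat_ceil_mul_div_atTop r.2).comp
    (tendsto_atTop_add_const_right atTop (1 : ℝ) tendsto_natCast_atTop_atTop)
  refine h.congr fun n => ?_
  have : ⌈(r : ℝ) * (n + 1)⌉₊ = ⌈(n + 1) * r⌉₊ := by
    refine eq_of_forall_ge_iff fun k => ?_
    rw [Nat.ceil_le, Nat.ceil_le, ← NNReal.coe_le_coe]
    push_cast
    rw [mul_comm]
  simp [← this]

/-- The strong Markov property. -/
lemma IsWiener1.map_incrPath_stopping (hW : IsWiener1 W) (y : ℝ) {τ : Path1 → ℝ≥0∞}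
    (hτ : IsPathStopping τ) (c : ℝ≥0) :
    ((W y).restrict {w | τ w ≤ c}).map (fun w => incrPath (τ w).toNNReal w)
      = W y {w | τ w ≤ c} • W 0 := by
  have := hW.isProbabilityMeasure
  have hT : Measurable fun w => (τ w).toNNReal := hτ.measurable.ennreal_toNNReal
  have hm : Measurable fun w => incrPath (τ w).toNNReal w :=
    continuous_incrPath.measurable.comp (hT.prodMk measurable_id)
  have hmn : ∀ n : ℕ, Measurable
      fun w => incrPath ((⌈(n + 1) * (τ w).toNNReal⌉₊ : ℝ≥0) / (n + 1)) w := by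
    intro n
    refine continuous_incrPath.measurable.comp (Measurable.prodMk ?_ measurable_id)
    exact ((measurable_from_top (f := fun k : ℕ => (k : ℝ≥0))).comp
      (Nat.measurable_ceil.comp (hT.const_mul _))).div_const _
  refine ext_of_forall_lintegral_eq_of_IsFiniteMeasure fun f => ?_
  have hf : Measurable fun w => (f w : ℝ≥0∞) := by fun_prop
  have hlim := tendsto_lintegral_of_dominated_convergence
    (μ := (W y).restrict {w | τ w ≤ c})
    (F := fun (n : ℕ) w =>
      (f (incrPath ((⌈(n + 1) * (τ w).toNNReal⌉₊ : ℝ≥0) / (n + 1)) w) : ℝ≥0∞))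
    (f := fun w => (f (incrPath (τ w).toNNReal w) : ℝ≥0∞))
    (fun _ => (nndist f 0 : ℝ≥0∞)) (fun n => hf.comp (hmn n))
    (fun n => ae_of_all _ fun w => ?_) (by simp [ENNReal.mul_eq_top]) (ae_of_all _ fun w => ?_)
  · have hn : ∀ n : ℕ,
        ∫⁻ w, (f (incrPath ((⌈(n + 1) * (τ w).toNNReal⌉₊ : ℝ≥0) / (n + 1)) w) : ℝ≥0∞)
        ∂((W y).restrict {w | τ w ≤ c}) = ∫⁻ w, f w ∂(W y {w | τ w ≤ c} • W 0) := by
      intro n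
      rw [← hW.map_incrPath_ceil y hτ c n, lintegral_map hf (hmn n)]
    rw [lintegral_map hf hm]
    simp_rw [hn] at hlim
    exact tendsto_nhds_unique hlim tendsto_const_nhds
  · exact ENNReal.coe_le_coe.2 (BoundedContinuousFunction.NNReal.upper_bound f _)
  · have hcont : Continuous fun r : ℝ≥0 => (f (incrPath r w) : ℝ≥0∞) :=
      ENNReal.continuous_coe.comp (f.continuous.comp
        (continuous_incrPath.comp (by fun_prop : Continuous fun r : ℝ≥0 => (r, w))))
    exact (hcont.tendsto _).comp (tendsto_ceil_mul_div _)

end StrongMarkov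

section FirstTime

/-- The first time in a set of times, `∞` if the set is empty. -/
def firstTime (S : Set ℝ≥0) : ℝ≥0∞ := sInf (((↑) : ℝ≥0 → ℝ≥0∞) '' S)

lemma firstTime_le_of_mem {S : Set ℝ≥0} {t : ℝ≥0} (ht : t ∈ S) : firstTime S ≤ t :=
  sInf_le ⟨t, ht, rfl⟩

lemma firstTime_lt_iff {S : Set ℝ≥0} {c : ℝ≥0∞} : firstTime S < c ↔ ∃ t ∈ S, (t : ℝ≥0∞) < c := by
  simp [firstTime, sInf_lt_iff]

lemma toNNReal_firstTime_mem {S : Set ℝ≥0} (hS : IsClosed S) (h : firstTime S < ∞) :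
    (firstTime S).toNNReal ∈ S := by
  obtain ⟨t, ht, -⟩ := firstTime_lt_iff.1 h
  have : firstTime S = (sInf S : ℝ≥0) := by
    rw [ENNReal.coe_sInf ⟨t, ht⟩, firstTime, sInf_image]
  rw [this, ENNReal.toNNReal_coe]
  exact hS.csInf_mem ⟨t, ht⟩ (OrderBot.bddBelow S)

lemma firstTime_le_coe_iff {S : Set ℝ≥0} (hS : IsClosed S) {c : ℝ≥0} :
    firstTime S ≤ c ↔ ∃ t ≤ c, t ∈ S := by
  refine ⟨fun h => ?_, fun ⟨t, htc, ht⟩ => (firstTime_le_of_mem ht).trans (by exact_mod_cast htc)⟩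
  have hlt : firstTime S < ∞ := h.trans_lt coe_lt_top
  refine ⟨_, ?_, toNNReal_firstTime_mem hS hlt⟩
  rwa [← ENNReal.coe_le_coe, ENNReal.coe_toNNReal hlt.ne]

lemma firstTime_eq_add {S : Set ℝ≥0} {r : ℝ≥0} (h : ∀ t ∈ S, r ≤ t) :
    firstTime S = r + firstTime {u | r + u ∈ S} := by
  rw [firstTime, firstTime, ENNReal.add_sInf, iInf_image, sInf_image]
  apply le_antisymm
  · refine le_iInf₂ fun u hu => ?_
    exact (iInf₂_le (r + u) hu).trans (by simp)
  · refine le_iInf₂ fun t ht => ?_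
    have e : r + (t - r) = t := add_tsub_cancel_of_le (h t ht)
    refine (iInf₂_le (t - r) (by simpa [e] using ht)).trans ?_
    rw [← ENNReal.coe_add, e]

lemma isClosed_exists_le {F : Set (ℝ≥0 × Path1)} (hF : IsClosed F) (c : ℝ≥0) :
    IsClosed {w : Path1 | ∃ t ≤ c, (t, w) ∈ F} := by
  have : CompactSpace (Set.Icc 0 c) := isCompact_iff_compactSpace.1 isCompact_Icc
  have hc : Continuous fun p : Set.Icc 0 c × Path1 => ((p.1 : ℝ≥0), p.2) := by fun_prop
  convert isClosedMap_snd_of_compactSpace _ (hF.preimage hc) using 1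
  ext w
  simp

/-- The first time a path visits the level `a`. -/
def hitTime (a : ℝ) (w : Path1) : ℝ≥0∞ := firstTime {t | w t = a}

lemma isClosed_level (a : ℝ) (w : Path1) : IsClosed {t : ℝ≥0 | w t = a} :=
  isClosed_eq (by fun_prop) continuous_const

lemma hitTime_le_coe_iff {a : ℝ} {w : Path1} {c : ℝ≥0} :
    hitTime a w ≤ c ↔ ∃ t ≤ c, w t = a := firstTime_le_coe_iff (isClosed_level a w)

lemma hitTime_lt_top_iff {a : ℝ} {w : Path1} : hitTime a w < ∞ ↔ ∃ t, w t = a := by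
  simp [hitTime, firstTime_lt_iff]

lemma apply_hitTime {a : ℝ} {w : Path1} (h : hitTime a w < ∞) : w (hitTime a w).toNNReal = a :=
  toNNReal_firstTime_mem (isClosed_level a w) h

lemma isPathStopping_hitTime (a : ℝ) : IsPathStopping (hitTime a) where
  measurable := by
    refine measurable_of_Iic fun c => ?_
    induction c with
    | top => simp
    | coe c =>
      have : hitTime a ⁻¹' Set.Iic (c : ℝ≥0∞)
          = {w | ∃ t ≤ c, (t, w) ∈ {p : ℝ≥0 × Path1 | p.2 p.1 = a}} := by
        ext w
        exact hitTime_le_coe_iff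
      rw [this]
      exact (isClosed_exists_le (isClosed_eq (by fun_prop) continuous_const) c).measurableSet
  stop_le_iff t w := by
    simp only [hitTime_le_coe_iff, stopPath_apply]
    exact exists_congr fun s => and_congr_right fun hs => by rw [min_eq_left hs]

lemma exists_apply_eq_of_le {a : ℝ} {w : Path1} {s t : ℝ≥0} (hs : w s ≤ a) (ht : a ≤ w t) :
    ∃ u ≤ max s t, w u = a := by
  obtain ⟨u, hu, rfl⟩ := intermediate_value_uIcc (f := w) (a := s) (b := t)
    w.continuous.continuousOn (Set.Icc_subset_uIcc ⟨hs, ht⟩)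
  exact ⟨u, hu.2, rfl⟩

end FirstTime

section HitStay

/-- The times at which a path is at level `x` and then stays positive for a unit of time. -/
def stayTimes (x : ℝ) (w : Path1) : Set ℝ≥0 :=
  {t : ℝ≥0 | w t = x ∧ ∀ s : ℝ≥0, t < s → s ≤ t + 1 → 0 < w s}

lemma hitStay_eq_firstTime (x : ℝ) (w : Path1) : hitStay x w = firstTime (stayTimes x w) := rfl

lemma stayTimes_shiftPath (x : ℝ) (r : ℝ≥0) (w : Path1) :
    stayTimes x (shiftPath r w) = {u | r + u ∈ stayTimes x w} := by
  ext u
  simp only [stayTimes, Set.mem_ofPred_eq, shiftPath_apply]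
  refine and_congr_right fun _ => ⟨fun h s h1 h2 => ?_, fun h s h1 h2 => ?_⟩
  · have e : r + (s - r) = s := add_tsub_cancel_of_le (le_self_add.trans h1.le)
    have := h (s - r) (by rw [← e] at h1; exact lt_of_add_lt_add_left h1)
      (by rw [← e, add_assoc] at h2; exact le_of_add_le_add_left h2)
    rwa [e] at this
  · exact h _ (by gcongr) (by rw [add_assoc]; gcongr)

lemma hitStay_eq_add {x : ℝ} {r : ℝ≥0} {w : Path1} (h : ∀ t ∈ stayTimes x w, r ≤ t) :
    hitStay x w = r + hitStay x (shiftPath r w) := by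
  rw [hitStay_eq_firstTime, hitStay_eq_firstTime, stayTimes_shiftPath, firstTime_eq_add h]

lemma sectionMap_shiftPath {x : ℝ} {r : ℝ≥0} {w : Path1} (h : ∀ t ∈ stayTimes x w, r ≤ t)
    (hw : hitStay x (shiftPath r w) < ∞) : sectionMap x (shiftPath r w) = sectionMap x w := by
  ext s
  change w (r + ((hitStay x (shiftPath r w)).toNNReal + s)) = w ((hitStay x w).toNNReal + s)
  rw [hitStay_eq_add h, ENNReal.toNNReal_add coe_ne_top hw.ne, ENNReal.toNNReal_coe, add_assoc]

lemma measurable_hitStay {x : ℝ} (hx : 0 < x) : Measurable (hitStay x) := by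
  refine measurable_of_Iio fun c => ?_
  have key : hitStay x ⁻¹' Set.Iio c = ⋃ (q : ℚ) (_ : (Real.toNNReal q : ℝ≥0∞) < c) (n : ℕ),
      {w | ∃ t ≤ Real.toNNReal q, (t, w) ∈ {p : ℝ≥0 × Path1 | p.2 p.1 = x} ∩
        ⋂ s ∈ Set.Icc (0 : ℝ≥0) 1, {p : ℝ≥0 × Path1 | 1 / ((n : ℝ) + 1) ≤ p.2 (p.1 + s)}} := by
    ext w
    simp only [Set.mem_preimage, Set.mem_Iio, hitStay_eq_firstTime, firstTime_lt_iff,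
      Set.mem_iUnion, Set.mem_ofPred_eq, Set.mem_inter_iff, Set.mem_iInter, exists_prop, stayTimes]
    constructor
    · rintro ⟨t, ⟨htx, hpos⟩, htc⟩
      obtain ⟨q, hq1, hq2⟩ : ∃ q : ℚ, t ≤ Real.toNNReal q ∧ (Real.toNNReal q : ℝ≥0∞) < c := by
        obtain ⟨q, -, h1, h2⟩ := ENNReal.lt_iff_exists_rat_btwn.1 htc
        exact ⟨q, by exact_mod_cast h1.le, h2⟩
      obtain ⟨s₀, hs₀, hmin⟩ := (isCompact_Icc (a := (0 : ℝ≥0)) (b := 1)).exists_isMinOn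
        ⟨0, by simp⟩ (f := fun s => w (t + s)) (by fun_prop)
      have hp : 0 < w (t + s₀) := by
        rcases eq_or_ne s₀ 0 with rfl | h0
        · simpa [htx] using hx
        · exact hpos _ (by simpa using pos_iff_ne_zero.2 h0) (by gcongr; exact hs₀.2)
      obtain ⟨n, hn⟩ := exists_nat_one_div_lt hp
      exact ⟨q, hq2, n, t, hq1, htx, fun s hs => hn.le.trans (hmin hs)⟩
    · rintro ⟨q, hq, n, t, htq, htx, h⟩
      refine ⟨t, ⟨htx, fun s h1 h2 => ?_⟩, lt_of_le_of_lt (by exact_mod_cast htq) hq⟩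
      have e : t + (s - t) = s := add_tsub_cancel_of_le h1.le
      have := h (s - t) ⟨zero_le, tsub_le_iff_left.2 h2⟩
      rw [e] at this
      exact lt_of_lt_of_le (by positivity) this
  rw [key]
  refine MeasurableSet.iUnion fun q => MeasurableSet.iUnion fun _ => MeasurableSet.iUnion fun n =>
    (isClosed_exists_le (IsClosed.inter ?_ (isClosed_biInter fun s _ => ?_)) _).measurableSet
  · exact isClosed_eq (by fun_prop) continuous_const
  · exact isClosed_le continuous_const (by fun_prop)

lemma measurable_sectionMap {x : ℝ} (hx : 0 < x) : Measurable (sectionMap x) :=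
  continuous_shiftPath.measurable.comp
    ((measurable_hitStay hx).ennreal_toNNReal.prodMk measurable_id)

/-- For a path started at `x > 0`, being positive up to time `1` is the same as not visiting `0`. -/
lemma one_lt_exitTimePos_iff {w : Path1} (h0 : 0 < w 0) :
    1 < exitTimePos w ↔ ¬ hitTime 0 w ≤ 1 := by
  have hcl : IsClosed {t : ℝ≥0 | 0 < t ∧ w t ≤ 0} := by
    have : {t : ℝ≥0 | 0 < t ∧ w t ≤ 0} = {t | w t ≤ 0} := by
      ext t
      refine ⟨fun h => h.2, fun h => ⟨pos_iff_ne_zero.2 ?_, h⟩⟩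
      rintro rfl
      exact absurd h (not_le.2 h0)
    rw [this]
    exact isClosed_le (by fun_prop) continuous_const
  rw [← not_le, not_iff_not]
  change firstTime {t : ℝ≥0 | 0 < t ∧ w t ≤ 0} ≤ ((1 : ℝ≥0) : ℝ≥0∞)
    ↔ hitTime 0 w ≤ ((1 : ℝ≥0) : ℝ≥0∞)
  rw [firstTime_le_coe_iff hcl, hitTime_le_coe_iff]
  constructor
  · rintro ⟨t, ht1, -, ht⟩
    obtain ⟨u, hu, hu0⟩ := exists_apply_eq_of_le ht h0.le
    exact ⟨u, hu.trans (by simpa using ht1), hu0⟩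
  · rintro ⟨t, ht1, ht⟩
    refine ⟨t, ht1, pos_iff_ne_zero.2 ?_, ht.le⟩
    rintro rfl
    exact h0.ne' ht

lemma pos_of_lt_hitTime_zero {w : Path1} (h0 : 0 < w 0) {t : ℝ≥0} (ht : (t : ℝ≥0∞) < hitTime 0 w) :
    0 < w t := by
  by_contra! h
  obtain ⟨u, hu, hu0⟩ := exists_apply_eq_of_le h h0.le
  exact ht.not_ge (hitTime_le_coe_iff.2 ⟨u, by simpa using hu, hu0⟩)

lemma hitStay_eq_zero {w : Path1} (h0 : 0 < w 0) (h : ¬ hitTime 0 w ≤ 1) :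
    hitStay (w 0) w = 0 := by
  refine le_antisymm ?_ zero_le
  refine firstTime_le_of_mem (S := stayTimes (w 0) w) (t := 0) ⟨rfl, fun s _ hs => ?_⟩
  refine pos_of_lt_hitTime_zero h0 (lt_of_le_of_lt ?_ (not_le.1 h))
  exact_mod_cast (by simpa using hs : s ≤ 1)

lemma sectionMap_eq_self {w : Path1} (h0 : 0 < w 0) (h : ¬ hitTime 0 w ≤ 1) :
    sectionMap (w 0) w = w := by
  ext s
  change w ((hitStay (w 0) w).toNNReal + s) = w s
  simp [hitStay_eq_zero h0 h]

lemma hitTime_le_of_mem_stayTimes {x : ℝ} {w : Path1} {t : ℝ≥0} (ht : t ∈ stayTimes x w) :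
    (hitTime x w).toNNReal ≤ t := by
  have h : hitTime x w ≤ t := firstTime_le_of_mem ht.1
  simpa using ENNReal.toNNReal_mono coe_ne_top h

/-- If a path visits `0` by time `1`, it visits `0` before the first stretch counted by
`hitStay`. -/
lemma hitTime_zero_le_of_mem_stayTimes {x : ℝ} {w : Path1} (h : hitTime 0 w ≤ 1) {t : ℝ≥0}
    (ht : t ∈ stayTimes x w) : (hitTime 0 w).toNNReal ≤ t := by
  by_contra! hlt
  have hz := apply_hitTime (h.trans_lt one_lt_top)
  have h1 : (hitTime 0 w).toNNReal ≤ 1 := by simpa using ENNReal.toNNReal_mono one_ne_top h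
  exact (ht.2 _ hlt (h1.trans le_add_self)).ne' hz

end HitStay

section Recurrence

variable {W : ℝ → Measure Path1}

/-- The strong Markov property at the hitting time of a level. -/
lemma IsWiener1.measure_hitTime_le_inter (hW : IsWiener1 W) (y a : ℝ) (c : ℝ≥0) {B : Set Path1}
    (hB : MeasurableSet B) :
    W y ({w | hitTime a w ≤ c} ∩ {w | shiftPath (hitTime a w).toNNReal w ∈ B})
      = W y {w | hitTime a w ≤ c} * W a B := by
  have hT := isPathStopping_hitTime a
  have hm : Measurable fun w => incrPath (hitTime a w).toNNReal w :=
    continuous_incrPath.measurable.comp (hT.measurable.ennreal_toNNReal.prodMk measurable_id)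
  have hB' := (continuous_translatePath a).measurable hB
  have h := congrArg (fun μ => μ (translatePath a ⁻¹' B)) (hW.map_incrPath_stopping y hT c)
  rw [Measure.map_apply hm hB', Measure.restrict_apply (hm hB'), Measure.smul_apply, smul_eq_mul,
    ← Measure.map_apply (continuous_translatePath a).measurable hB,
    ← hW.eq_map_translatePath a, Set.inter_comm] at h
  rw [← h]
  congr 1
  ext w
  refine and_congr_right fun hw => ?_
  have hw' : w (hitTime a w).toNNReal = a := apply_hitTime (lt_of_le_of_lt hw coe_lt_top)
  have : translatePath a (incrPath (hitTime a w).toNNReal w)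
      = shiftPath (hitTime a w).toNNReal w := by
    ext s; simp [hw']
  rw [Set.mem_preimage, Set.mem_preimage, this]
  rfl

lemma IsWiener1.measure_hitTime_lt_top_inter (hW : IsWiener1 W) (y a : ℝ) {B : Set Path1}
    (hB : MeasurableSet B) :
    W y ({w | hitTime a w < ∞} ∩ {w | shiftPath (hitTime a w).toNNReal w ∈ B})
      = W y {w | hitTime a w < ∞} * W a B := by
  have hU : {w | hitTime a w < ∞} = ⋃ n : ℕ, {w | hitTime a w ≤ (n : ℝ≥0)} := by
    ext w
    simp only [Set.mem_ofPred_eq, Set.mem_iUnion]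
    refine ⟨fun h => ?_, fun ⟨n, hn⟩ => hn.trans_lt coe_lt_top⟩
    obtain ⟨n, hn⟩ := ENNReal.exists_nat_gt h.ne
    exact ⟨n, by simpa using hn.le⟩
  have hmono : Monotone fun n : ℕ => {w | hitTime a w ≤ (n : ℝ≥0)} := by
    intro m n hmn w hw
    exact le_trans (show hitTime a w ≤ ((m : ℝ≥0) : ℝ≥0∞) from hw) (by exact_mod_cast hmn)
  have h1 := tendsto_measure_iUnion_atTop (μ := W y) hmono
  have h2 := tendsto_measure_iUnion_atTop (μ := W y)
    (s := fun n : ℕ => {w | hitTime a w ≤ (n : ℝ≥0)} ∩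
      {w | shiftPath (hitTime a w).toNNReal w ∈ B})
    fun m n hmn => Set.inter_subset_inter_left _ (hmono hmn)
  rw [← Set.iUnion_inter, ← hU] at h2
  rw [← hU] at h1
  have := hW.isProbabilityMeasure
  refine tendsto_nhds_unique h2 ?_
  have h3 := ENNReal.Tendsto.mul_const (b := W a B) h1 (Or.inr (measure_ne_top _ _))
  refine h3.congr fun n => ?_
  exact (hW.measure_hitTime_le_inter y a n hB).symm

lemma IsWiener1.hasLaw_eval (hW : IsWiener1 W) (t : ℝ≥0) :
    HasLaw (fun w : Path1 => w t) (gaussianReal 0 t) (W 0) := by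
  simpa using (hW.isPreBrownianReal 0).hasLaw_eval t

/-- The probability that Brownian motion at time `t` exceeds one standard deviation does not
depend on `t`. -/
lemma IsWiener1.measure_sqrt_le (hW : IsWiener1 W) (y : ℝ≥0) :
    W 0 {w | (y : ℝ) ≤ w (y ^ 2)} = gaussianReal 0 1 {z | (y : ℝ) ≤ y * z} := by
  rw [(hW.hasLaw_eval (y ^ 2)).measure_eq (p := fun z => (y : ℝ) ≤ z) measurableSet_Ici]
  have h := gaussianReal_map_const_mul (μ := 0) (v := 1) (y : ℝ)
  have e : (NNReal.mk ((y : ℝ) ^ 2) (sq_nonneg _)) * 1 = y ^ 2 := by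
    ext; simp
  rw [e, mul_zero] at h
  rw [← h]
  exact Measure.map_apply (by fun_prop) measurableSet_Ici

lemma gaussianReal_Ici_one_pos : 0 < gaussianReal 0 1 (Set.Ici 1) := by
  refine pos_iff_ne_zero.2 fun h => ?_
  have := gaussianReal_absolutelyContinuous' 0 one_ne_zero h
  simp at this

lemma IsWiener1.gaussianReal_le (hW : IsWiener1 W) (y : ℝ≥0) :
    gaussianReal 0 1 (Set.Ici 1) ≤ W 0 {w | (y : ℝ) ≤ w (y ^ 2)} := by
  rw [hW.measure_sqrt_le]
  exact measure_mono fun z hz => le_mul_of_one_le_right y.2 hz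

lemma IsWiener1.gaussianReal_le_measure_hitTime (hW : IsWiener1 W) (y : ℝ≥0) :
    gaussianReal 0 1 (Set.Ici 1) ≤ W 0 {w | hitTime y w < ∞} := by
  refine (hW.gaussianReal_le y).trans (measure_mono_ae ?_)
  filter_upwards [hW.ae_start 0] with w hw h
  obtain ⟨u, -, hu⟩ := exists_apply_eq_of_le (a := y) (s := 0) (by simp [hw]) h
  exact hitTime_lt_top_iff.2 ⟨u, hu⟩

lemma measurableSet_hitTime_lt_top (a : ℝ) : MeasurableSet {w | hitTime a w < ∞} :=
  measurableSet_lt (isPathStopping_hitTime a).measurable measurable_const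

lemma IsWiener1.measure_hitTime_add_le (hW : IsWiener1 W) (x y : ℝ≥0) :
    W 0 {w | hitTime (y + x : ℝ≥0) w < ∞}
      ≤ W 0 {w | hitTime x w < ∞} * W 0 {w | hitTime y w < ∞} := by
  have e : W 0 {w | hitTime y w < ∞} = W x {w | hitTime (y + x : ℝ≥0) w < ∞} := by
    rw [hW.eq_map_translatePath x, Measure.map_apply (continuous_translatePath _).measurable
      (measurableSet_hitTime_lt_top _)]
    congr 1
    ext w
    simp [hitTime_lt_top_iff]
  rw [e, ← hW.measure_hitTime_lt_top_inter 0 x (measurableSet_hitTime_lt_top _)]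
  refine measure_mono_ae ?_
  filter_upwards [hW.ae_start 0] with w hw h
  obtain ⟨t, ht⟩ := hitTime_lt_top_iff.1 h
  obtain ⟨u, hut, hu⟩ := exists_apply_eq_of_le (a := x) (s := 0) (w := w) (t := t) (by simp [hw])
    (by simp [ht])
  have hx : hitTime x w < ∞ := hitTime_lt_top_iff.2 ⟨u, hu⟩
  refine ⟨hx, hitTime_lt_top_iff.2 ?_⟩
  have hle : (hitTime x w).toNNReal ≤ t := by
    simpa using ENNReal.toNNReal_mono coe_ne_top
      (hitTime_le_coe_iff.2 ⟨u, by simpa using hut, hu⟩)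
  exact ⟨t - (hitTime x w).toNNReal, by rw [shiftPath_apply, add_tsub_cancel_of_le hle, ht]⟩

/-- Brownian motion started at `0` visits every positive level almost surely. -/
lemma IsWiener1.measure_hitTime_lt_top (hW : IsWiener1 W) (x : ℝ≥0) :
    W 0 {w | hitTime x w < ∞} = 1 := by
  have := hW.isProbabilityMeasure
  have hpow : ∀ n : ℕ, W 0 {w | hitTime ((n * x : ℝ≥0)) w < ∞} ≤ W 0 {w | hitTime x w < ∞} ^ n := by
    intro n
    induction n with
    | zero => simpa using prob_le_one
    | succ n ih =>
      push_cast at ih ⊢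
      have := hW.measure_hitTime_add_le x (n * x)
      push_cast at this
      rw [add_one_mul, pow_succ']
      exact this.trans (by gcongr)
  refine prob_le_one.antisymm (not_lt.1 fun hlt => ?_)
  have h0 := ENNReal.tendsto_pow_atTop_nhds_zero_of_lt_one hlt
  have := ge_of_tendsto' h0 fun n =>
    (hW.gaussianReal_le_measure_hitTime (n * x)).trans (hpow n)
  exact gaussianReal_Ici_one_pos.not_ge this

end Recurrence

section Survival

variable {W : ℝ → Measure Path1}

/-- Paths that stay above `-x` up to time `t` and are nonnegative at time `t`. -/
def aboveSet (x : ℝ) (t : ℝ≥0) : Set Path1 := {w | (∀ s ≤ t, -x < w s) ∧ 0 ≤ w t}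

lemma measurableSet_exists_le (a : ℝ) (t : ℝ≥0) :
    MeasurableSet {w : Path1 | ∃ s ≤ t, w s ≤ a} := by
  have := isClosed_exists_le (F := {p : ℝ≥0 × Path1 | p.2 p.1 ≤ a})
    (isClosed_le (by fun_prop) continuous_const) t
  exact this.measurableSet

lemma aboveSet_eq (x : ℝ) (t : ℝ≥0) :
    aboveSet x t = {w | 0 ≤ w t} \ {w | ∃ s ≤ t, w s ≤ -x} := by
  ext w
  simp only [aboveSet, Set.mem_ofPred_eq, Set.mem_sdiff]
  push Not
  exact and_comm

lemma measurableSet_aboveSet (x : ℝ) (t : ℝ≥0) : MeasurableSet (aboveSet x t) := by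
  rw [aboveSet_eq]
  refine MeasurableSet.diff ?_ (measurableSet_exists_le _ _)
  exact (isClosed_le continuous_const (by fun_prop)).measurableSet

lemma IsWiener1.pow_measure_aboveSet_le (hW : IsWiener1 W) {x : ℝ} (hx : 0 < x) (ε : ℝ≥0) (k : ℕ) :
    W 0 (aboveSet x ε) ^ k ≤ W 0 (aboveSet x (k * ε)) := by
  have := hW.isProbabilityMeasure
  induction k with
  | zero =>
    have : W 0 (aboveSet x ((0 : ℕ) * ε)) = 1 := by
      refine (prob_compl_eq_zero_iff (measurableSet_aboveSet _ _)).1 ?_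
      filter_upwards [hW.ae_start 0] with w hw
      simp only [CharP.cast_eq_zero, zero_mul]
      refine ⟨fun s hs => ?_, hw.ge⟩
      rw [le_zero_iff.1 hs, hw]
      linarith
    rw [this, pow_zero]
  | succ k ih =>
    have hst : ∀ w, stopPath (k * ε) w ∈ aboveSet x (k * ε) ↔ w ∈ aboveSet x (k * ε) := by
      intro w
      simp only [aboveSet, Set.mem_ofPred_eq, stopPath_apply, min_self]
      refine and_congr_left fun _ => forall₂_congr fun s hs => by rw [min_eq_left hs]
    rw [pow_succ]
    refine (mul_le_mul_left ih _).trans ?_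
    rw [← hW.measure_inter_incrPath 0 (k * ε) (measurableSet_aboveSet _ _) hst
      (measurableSet_aboveSet x ε)]
    refine measure_mono ?_
    rintro w ⟨⟨h1, h2⟩, h3, h4⟩
    simp only [incrPath_apply] at h3 h4
    have e : ((k + 1 : ℕ) : ℝ≥0) * ε = k * ε + ε := by push_cast; ring
    rw [e]
    refine ⟨fun s hs => ?_, by linarith⟩
    rcases le_total s (k * ε) with h | h
    · exact h1 s h
    · have := h3 (s - k * ε) (tsub_le_iff_left.2 hs)
      rw [add_tsub_cancel_of_le h] at this
      linarith

lemma IsWiener1.exists_measure_aboveSet_pos (hW : IsWiener1 W) {x : ℝ} (hx : 0 < x) :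
    ∃ n : ℕ, 0 < W 0 (aboveSet x ((1 : ℝ≥0) / (n + 1))) := by
  have := hW.isProbabilityMeasure
  set δ : ℕ → ℝ≥0 := fun n => 1 / (n + 1) with hδ
  have hδ0 : Tendsto δ atTop (𝓝 0) := tendsto_one_div_add_atTop_nhds_zero_nat
  have hanti : Antitone fun n => {w : Path1 | ∃ s ≤ δ n, w s ≤ -x} := by
    rintro m n hmn w ⟨s, hs, hw⟩
    exact ⟨s, hs.trans (by simp only [hδ]; gcongr), hw⟩
  have hlim := tendsto_measure_iInter_atTop (μ := W 0)
    (fun n => (measurableSet_exists_le (-x) (δ n)).nullMeasurableSet) hanti ⟨0, measure_ne_top _ _⟩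
  have hzero : W 0 (⋂ n, {w : Path1 | ∃ s ≤ δ n, w s ≤ -x}) = 0 := by
    refine measure_mono_null ?_ (hW.ae_start 0)
    intro w hw h0
    simp only [Set.mem_iInter, Set.mem_ofPred_eq] at hw
    choose s hs hws using hw
    have hs0 : Tendsto s atTop (𝓝 0) :=
      tendsto_of_tendsto_of_tendsto_of_le_of_le tendsto_const_nhds hδ0 (fun _ => zero_le) hs
    have := le_of_tendsto' ((w.continuous.tendsto 0).comp hs0) hws
    change w 0 = 0 at h0
    rw [h0] at this
    linarith
  rw [hzero] at hlim
  obtain ⟨n, hn⟩ := (hlim.eventually (gt_mem_nhds gaussianReal_Ici_one_pos)).exists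
  refine ⟨n, ?_⟩
  have h1 : gaussianReal 0 1 (Set.Ici 1) ≤ W 0 {w | 0 ≤ w (δ n)} := by
    refine (hW.gaussianReal_le (NNReal.sqrt (δ n))).trans (measure_mono fun w hw => ?_)
    rw [Set.mem_ofPred_eq, NNReal.sq_sqrt] at hw
    exact le_trans (NNReal.coe_nonneg _) hw
  change 0 < W 0 (aboveSet x (δ n))
  rw [aboveSet_eq]
  exact (tsub_pos_of_lt (lt_of_lt_of_le hn h1)).trans_le le_measure_sdiff

/-- With positive probability, Brownian motion started at `x > 0` stays positive up to time `1`. -/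
lemma IsWiener1.measure_hitTime_zero_le_one_lt (hW : IsWiener1 W) {x : ℝ} (hx : 0 < x) :
    W x {w | hitTime 0 w ≤ 1} < 1 := by
  have := hW.isProbabilityMeasure
  obtain ⟨n, hn⟩ := hW.exists_measure_aboveSet_pos hx
  have hpos : 0 < W 0 (aboveSet x 1) := by
    have h := hW.pow_measure_aboveSet_le hx (1 / (n + 1)) (n + 1)
    have e : ((n + 1 : ℕ) : ℝ≥0) * (1 / (n + 1)) = 1 := by
      push_cast
      exact mul_one_div_cancel (by positivity)
    rw [e] at h
    exact (ENNReal.pow_pos hn _).trans_le h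
  have hm : MeasurableSet {w | hitTime 0 w ≤ 1} :=
    measurableSet_le (isPathStopping_hitTime 0).measurable measurable_const
  rw [hW.eq_map_translatePath x, Measure.map_apply (continuous_translatePath x).measurable hm]
  calc W 0 (translatePath x ⁻¹' {w | hitTime 0 w ≤ 1}) ≤ W 0 (aboveSet x 1)ᶜ := by
        refine measure_mono fun w hw hw' => ?_
        obtain ⟨t, ht, h0⟩ := (hitTime_le_coe_iff (c := 1)).1 hw
        have := hw'.1 t ht
        rw [translatePath_apply] at h0
        linarith
    _ < 1 := by
        rw [prob_compl_eq_one_sub (measurableSet_aboveSet _ _)]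
        exact ENNReal.sub_lt_self one_ne_top one_ne_zero hpos.ne'

end Survival

section Conditioning

variable {W : ℝ → Measure Path1}

/-- The paths for which the section map is well defined and takes values in `A`. -/
def sectionSet (x : ℝ) (A : Set Path1) : Set Path1 := {w | hitStay x w < ∞ ∧ sectionMap x w ∈ A}

lemma measurableSet_sectionSet {x : ℝ} (hx : 0 < x) {A : Set Path1} (hA : MeasurableSet A) :
    MeasurableSet (sectionSet x A) :=
  (measurableSet_lt (measurable_hitStay hx) measurable_const).inter (measurable_sectionMap hx hA)

lemma shiftPath_mem_sectionSet_iff {x : ℝ} {A : Set Path1} {r : ℝ≥0} {w : Path1}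
    (h : ∀ t ∈ stayTimes x w, r ≤ t) : shiftPath r w ∈ sectionSet x A ↔ w ∈ sectionSet x A := by
  have e : hitStay x (shiftPath r w) < ∞ ↔ hitStay x w < ∞ := by
    rw [hitStay_eq_add h, ENNReal.add_lt_top, and_iff_right coe_lt_top]
  rw [sectionSet, Set.mem_ofPred_eq, Set.mem_ofPred_eq, ← e]
  exact and_congr_right fun hw => by rw [sectionMap_shiftPath h hw]

lemma IsWiener1.measure_zero_sectionSet (hW : IsWiener1 W) {x : ℝ} (hx : 0 < x) {A : Set Path1}
    (hA : MeasurableSet A) : W 0 (sectionSet x A) = W x (sectionSet x A) := by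
  have h := hW.measure_hitTime_lt_top_inter 0 x (measurableSet_sectionSet hx hA)
  have h1 : W 0 {w | hitTime x w < ∞} = 1 := hW.measure_hitTime_lt_top ⟨x, hx.le⟩
  rw [h1, one_mul] at h
  rw [← h]
  congr 1
  ext w
  simp only [Set.mem_inter_iff, Set.mem_ofPred_eq,
    shiftPath_mem_sectionSet_iff fun t ht => hitTime_le_of_mem_stayTimes (x := x) (w := w) ht]
  refine ⟨fun hw => ⟨?_, hw⟩, fun hw => hw.2⟩
  obtain ⟨t, ht, -⟩ := firstTime_lt_iff.1 hw.1
  exact hitTime_lt_top_iff.2 ⟨t, ht.1⟩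

/-- Decomposition of the law of the section according to whether `0` is visited by time `1`. -/
lemma IsWiener1.measure_sectionSet (hW : IsWiener1 W) {x : ℝ} (hx : 0 < x) {A : Set Path1}
    (hA : MeasurableSet A) :
    W x (sectionSet x A) = W x {w | hitTime 0 w ≤ 1} * W x (sectionSet x A)
      + W x ({w | 1 < exitTimePos w} ∩ A) := by
  have hm : MeasurableSet {w | hitTime 0 w ≤ 1} :=
    measurableSet_le (isPathStopping_hitTime 0).measurable measurable_const
  rw [← measure_inter_add_sdiff (sectionSet x A) hm]
  congr 1
  · have h := hW.measure_hitTime_le_inter x 0 1 (measurableSet_sectionSet hx hA)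
    rw [measure_inter_add_sdiff _ hm, ← hW.measure_zero_sectionSet hx hA]
    rw [ENNReal.coe_one] at h
    rw [← h, Set.inter_comm]
    congr 1
    ext w
    refine and_congr_right fun hw => ?_
    exact (shiftPath_mem_sectionSet_iff fun t ht => hitTime_zero_le_of_mem_stayTimes hw ht).symm
  · refine measure_congr ?_
    filter_upwards [hW.ae_start x] with w hw
    subst hw
    refine propext ?_
    change (w ∈ sectionSet (w 0) A ∧ ¬ hitTime 0 w ≤ 1) ↔ (1 < exitTimePos w ∧ w ∈ A)
    rw [one_lt_exitTimePos_iff hx, and_comm]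
    refine and_congr_right fun h => ?_
    rw [sectionSet, Set.mem_ofPred_eq, sectionMap_eq_self hx h, hitStay_eq_zero hx h]
    simp

end Conditioning

/-- (Lemma 3.3, Durrett–Iglehart–Miller): for every `x > 0`, the conditioned law equals the
unconditioned image law: `W̃^+_{x,1} = W_0 ∘ φ_x⁻¹`. -/
theorem condPos_eq_map_sectionMap (W : ℝ → Measure Path1) (hW : IsWiener1 W)
    (x : ℝ) (hx : 0 < x) :
    condPos W x = (W 0).map (sectionMap x) := by
  have := hW.isProbabilityMeasure
  set q := W x {w | hitTime 0 w ≤ 1} with hq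
  have hq1 : q < 1 := hW.measure_hitTime_zero_le_one_lt hx
  have hqt : q ≠ ∞ := (hq1.trans one_lt_top).ne
  have key : ∀ A, MeasurableSet A →
      W x ({w | 1 < exitTimePos w} ∩ A) = (1 - q) * W x (sectionSet x A) := by
    intro A hA
    have h := hW.measure_sectionSet hx hA
    have hne : q * W x (sectionSet x A) ≠ ∞ := ENNReal.mul_ne_top hqt (measure_ne_top _ _)
    rw [ENNReal.sub_mul fun _ _ => measure_ne_top _ _, one_mul]
    exact ENNReal.eq_sub_of_add_eq hne (by rw [add_comm]; exact h.symm)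
  have hexit : W x {w | 1 < exitTimePos w} = 1 - q := by
    have hm : MeasurableSet {w | hitTime 0 w ≤ 1} :=
      measurableSet_le (isPathStopping_hitTime 0).measurable measurable_const
    rw [hq, ← prob_compl_eq_one_sub hm]
    refine measure_congr ?_
    filter_upwards [hW.ae_start x] with w hw
    exact propext (one_lt_exitTimePos_iff (hw ▸ hx))
  have hp0 : 1 - q ≠ 0 := (tsub_pos_of_lt hq1).ne'
  have hpt : 1 - q ≠ ∞ := ENNReal.sub_ne_top one_ne_top
  have htop : ∀ᵐ w ∂(W 0), hitStay x w < ∞ := by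
    have h := key Set.univ .univ
    rw [Set.inter_univ, hexit] at h
    have h1 : W 0 (sectionSet x Set.univ) = 1 := by
      rw [hW.measure_zero_sectionSet hx .univ]
      refine (ENNReal.mul_right_inj hp0 hpt).1 ?_
      rw [← h, mul_one]
    filter_upwards [(prob_compl_eq_zero_iff (measurableSet_sectionSet hx .univ)).2 h1]
      with w hw using hw.1
  ext A hA
  rw [condPos, cond_apply' hA, key A hA, hexit, ← mul_assoc, ENNReal.inv_mul_cancel hp0 hpt,
    one_mul, Measure.map_apply (measurable_sectionMap hx) hA, ← hW.measure_zero_sectionSet hx hA]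
  refine measure_congr ?_
  filter_upwards [htop] with w hw
  exact propext (and_iff_right hw)

end
end

section
/- Let d ≥ 2, D = {x ∈ ℝ^d : x_1 > 0}, H = {x ∈ ℝ^d : x_1 = 1}, e_1 = (1, 0, …, 0), B the open Euclidean ball of radius 1 centered at e_1, and for x ∈ ℝ^d let B(x) be the open ball of radius 1 centered at x. For a sign vector ε = (ε_2, …, ε_d) with each ε_i ∈ {−1, +1}, set D_ε = {x ∈ D : ε_2 x_2 > 0, …, ε_d x_d > 0} and ε̄ = (−ε_2, …, −ε_d). Then for every such ε and every x ∈ D_ε ∩ H, one has B(x) ∩ B^c ∩ D_{ε̄} = ∅. -/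
open MeasureTheory Filter Topology

noncomputable section

abbrev E (d : ℕ) : Type := EuclideanSpace ℝ (Fin d)

/-- The orthant `D_ε = {x ∈ D : ε_2 x_2 > 0, …, ε_d x_d > 0}` of the half-space
`D = {x : x₁ > 0}` associated with a sign vector `ε`. -/
def orthant {d : ℕ} [NeZero d] (ε : Fin d → ℝ) : Set (E d) :=
  {x : E d | 0 < x 0 ∧ ∀ i : Fin d, i ≠ 0 → 0 < ε i * x i}

/-- The Euclidean distance is monotone in the coordinatewise distances. -/
theorem EuclideanSpace.dist_le_dist_of_forall_dist_le {ι : Type*} [Fintype ι]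
    {x y z w : EuclideanSpace ℝ ι} (h : ∀ i, dist (x i) (y i) ≤ dist (z i) (w i)) :
    dist x y ≤ dist z w := by
  rw [EuclideanSpace.dist_eq, EuclideanSpace.dist_eq]
  gcongr with i
  exact h i

/-- **Geometric lemma** (Lemma 4.2): let `d ≥ 2`, `H = {x : x₁ = 1}`, `B` the open unit
ball centered at `e₁` and `B(x)` the open unit ball centered at `x`. For every sign vector
`ε` and every `x ∈ D_ε ∩ H`, one has `B(x) ∩ Bᶜ ∩ D_ε̄ = ∅`. -/
theorem ball_orthant_disjoint (d : ℕ) (ε : Fin (d + 2) → ℝ)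
    (hε : ∀ i : Fin (d + 2), i ≠ 0 → ε i = 1 ∨ ε i = -1)
    (x : E (d + 2)) (hx : x ∈ orthant ε) (hxH : x 0 = 1) :
    Metric.ball x 1 ∩ (Metric.ball (EuclideanSpace.single (0 : Fin (d + 2)) (1 : ℝ)) 1)ᶜ ∩
        orthant (fun i => -ε i)
      = ∅ := by
  refine Set.eq_empty_of_forall_notMem ?_
  rintro y ⟨⟨hyx, hyB⟩, -, hy⟩
  refine hyB ((EuclideanSpace.dist_le_dist_of_forall_dist_le fun i => ?_).trans_lt hyx)
  obtain rfl | hi := eq_or_ne i 0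
  · simp [hxH]
  · have hxi := hx.2 i hi
    have hyi : 0 < -ε i * y i := hy i hi
    rw [PiLp.single_eq_of_ne _ hi, Real.dist_eq, Real.dist_eq, ← sq_le_sq]
    obtain h | h := hε i hi <;> rw [h] at hxi hyi <;> nlinarith

end
end

section
/- Ball estimate: let d ≥ 2, D = {x ∈ ℝ^d : x_1 > 0}, e_1 = (1, 0, …, 0), and let B be the open ball of radius 1 centered at e_1. Then lim_{s → 0+} limsup_{λ → 0+} W̃^D_{λ e_1, 1}(τ_B ≤ s) = 0, where τ_B = inf{t > 0 : X_t ∉ B}. -/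
open MeasureTheory ProbabilityTheory Filter Topology NNReal ENNReal

noncomputable section

abbrev PathSpace (d : ℕ) : Type := C(ℝ≥0, E d)

instance (d : ℕ) : MeasurableSpace (PathSpace d) := borel _
instance (d : ℕ) : BorelSpace (PathSpace d) := ⟨rfl⟩

/-- `W` is the family of laws of standard `d`-dimensional Brownian motion:
`W x` is a probability measure on path space, starting a.s. at `x`, whose
increments have the finite-dimensional distributions of Brownian motion
(independent centered Gaussian coordinates with the right variances). -/
def IsWiener {d : ℕ} (W : E d → Measure (PathSpace d)) : Prop :=
  ∀ x : E d, IsProbabilityMeasure (W x) ∧ (W x) {w | w 0 = x} = 1 ∧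
    ∀ (n : ℕ) (t : Fin (n + 1) → ℝ≥0), Monotone t →
      (W x).map (fun w (p : Fin n × Fin d) => w (t p.1.succ) p.2 - w (t p.1.castSucc) p.2)
        = Measure.pi (fun p : Fin n × Fin d => gaussianReal 0 (t p.1.succ - t p.1.castSucc))

/-- First exit time from `U` : `τ_U = inf {t > 0 : X_t ∉ U}` (with value `∞` if the
path never leaves `U`). -/
def exitTime {d : ℕ} (U : Set (E d)) (w : PathSpace d) : ℝ≥0∞ :=
  sInf (((↑) : ℝ≥0 → ℝ≥0∞) '' {t : ℝ≥0 | 0 < t ∧ w t ∉ U})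

/-- The law `W̃^U_{x,1}` of Brownian motion started at `x` conditioned to stay in `U`
for a unit of time. -/
def condLaw {d : ℕ} (W : E d → Measure (PathSpace d)) (U : Set (E d)) (x : E d) :
    Measure (PathSpace d) :=
  ProbabilityTheory.cond (W x) {w | 1 < exitTime U w}

/-- The position after `k` steps of the walk started at `y` with increments `z`. -/
def walk {n : ℕ} (y : ℝ) (z : Fin n → ℝ) (k : ℕ) : ℝ :=
  y + ∑ i : Fin n, if (i : ℕ) < k then z i else 0

/-- The increment vectors for which the walk started at `y` stays positive. -/
def surviveSet (n : ℕ) (y : ℝ) : Set (Fin n → ℝ) := {z | ∀ k ≤ n, 0 < walk y z k}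

/-- The law of `n` independent centered Gaussian increments of variance `v`. -/
abbrev stepLaw (v : ℝ≥0) (n : ℕ) : Measure (Fin n → ℝ) :=
  Measure.pi fun _ => gaussianReal 0 v

@[simp] lemma walk_zero {n : ℕ} (y : ℝ) (z : Fin n → ℝ) : walk y z 0 = y := by
  simp [walk]

lemma walk_cons_succ {n : ℕ} (y x : ℝ) (z : Fin n → ℝ) (k : ℕ) :
    walk y (Fin.cons x z : Fin (n + 1) → ℝ) (k + 1) = walk (y + x) z k := by
  simp [walk, Fin.sum_univ_succ, add_assoc]

lemma walk_succ {n : ℕ} (y : ℝ) (z : Fin n → ℝ) (k : Fin n) :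
    walk y z (k + 1) = walk y z k + z k := by
  unfold walk
  rw [add_assoc]
  congr 1
  have h : ∀ i : Fin n, (if (i : ℕ) < k + 1 then z i else 0)
      = (if (i : ℕ) < k then z i else 0) + if i = k then z i else 0 := by
    intro i
    rcases lt_trichotomy (i : ℕ) k with h | h | h
    · rw [if_pos (by omega), if_pos h, if_neg (by rw [Fin.ext_iff]; omega), add_zero]
    · rw [if_pos (by omega), if_neg (by omega), if_pos (Fin.ext h), zero_add]
    · rw [if_neg (by omega), if_neg (by omega), if_neg (by rw [Fin.ext_iff]; omega), add_zero]
  rw [Finset.sum_congr rfl fun i _ => h i, Finset.sum_add_distrib]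
  simp

@[fun_prop]
lemma measurable_walk {n : ℕ} (k : ℕ) :
    Measurable fun p : ℝ × (Fin n → ℝ) => walk p.1 p.2 k := by
  unfold walk
  refine measurable_fst.add (Finset.measurable_sum _ fun i _ => ?_)
  split_ifs
  · exact (measurable_pi_apply i).comp measurable_snd
  · exact measurable_const

lemma measurable_walk_right {n : ℕ} (y : ℝ) (k : ℕ) :
    Measurable fun z : Fin n → ℝ => walk y z k :=
  (measurable_walk k).comp (measurable_const.prodMk measurable_id)

/-- First step decomposition of a Gaussian increment vector. -/
lemma stepLaw_succ_apply (v : ℝ≥0) (n : ℕ) {s : Set (Fin (n + 1) → ℝ)} (hs : MeasurableSet s) :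
    stepLaw v (n + 1) s
      = ∫⁻ x, stepLaw v n {z | (Fin.cons x z : Fin (n + 1) → ℝ) ∈ s} ∂gaussianReal 0 v := by
  have h := (measurePreserving_piFinSuccAbove
    (fun _ : Fin (n + 1) => gaussianReal 0 v) 0).symm
  rw [stepLaw, ← h.map_eq, Measure.map_apply h.measurable hs, Measure.prod_apply (h.measurable hs)]
  refine lintegral_congr fun x => congrArg _ ?_
  ext z
  simp [MeasurableEquiv.piFinSuccAbove, Fin.consEquiv]

lemma measurableSet_surviveSet (n : ℕ) (y : ℝ) : MeasurableSet (surviveSet n y) := by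
  unfold surviveSet
  have : {z : Fin n → ℝ | ∀ k ≤ n, 0 < walk y z k}
      = ⋂ k, ⋂ (_ : k ≤ n), {z | 0 < walk y z k} := by ext; simp
  rw [this]
  exact MeasurableSet.iInter fun k => MeasurableSet.iInter fun _ =>
    measurableSet_lt measurable_const (measurable_walk_right y k)

lemma forall_le_succ_iff {n : ℕ} {P : ℕ → Prop} :
    (∀ k ≤ n + 1, P k) ↔ P 0 ∧ ∀ k ≤ n, P (k + 1) := by
  constructor
  · intro h
    exact ⟨h 0 (by omega), fun k hk => h _ (by omega)⟩
  · rintro ⟨h0, h⟩ k hk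
    cases k with
    | zero => exact h0
    | succ k => exact h k (by omega)

lemma cons_mem_surviveSet_iff {n : ℕ} {y x : ℝ} {z : Fin n → ℝ} :
    (Fin.cons x z : Fin (n + 1) → ℝ) ∈ surviveSet (n + 1) y
      ↔ 0 < y ∧ z ∈ surviveSet n (y + x) := by
  change (∀ k ≤ n + 1, _) ↔ _ ∧ ∀ k ≤ n, _
  rw [forall_le_succ_iff]
  simp only [walk_zero, walk_cons_succ]

/-- The probability that the Gaussian walk started at `y` stays positive for `n` steps. -/
def surviveProb (v : ℝ≥0) (n : ℕ) (y : ℝ) : ℝ≥0∞ := stepLaw v n (surviveSet n y)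

lemma surviveProb_le_one (v : ℝ≥0) (n : ℕ) (y : ℝ) : surviveProb v n y ≤ 1 := prob_le_one

lemma surviveProb_of_nonpos (v : ℝ≥0) (n : ℕ) {y : ℝ} (hy : y ≤ 0) : surviveProb v n y = 0 := by
  have : surviveSet n y = ∅ := by
    refine Set.eq_empty_of_forall_notMem fun z hz => ?_
    have := hz 0 (Nat.zero_le _)
    rw [walk_zero] at this
    linarith
  rw [surviveProb, this, measure_empty]

lemma surviveProb_zero (v : ℝ≥0) {y : ℝ} (hy : 0 < y) : surviveProb v 0 y = 1 := by
  have : surviveSet 0 y = Set.univ := by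
    refine Set.eq_univ_of_forall fun z k hk => ?_
    obtain rfl : k = 0 := by omega
    simpa using hy
  rw [surviveProb, this, measure_univ]

lemma surviveProb_succ (v : ℝ≥0) (n : ℕ) {y : ℝ} (hy : 0 < y) :
    surviveProb v (n + 1) y = ∫⁻ x, surviveProb v n (y + x) ∂gaussianReal 0 v := by
  rw [surviveProb, stepLaw_succ_apply v n (measurableSet_surviveSet _ _)]
  simp only [cons_mem_surviveSet_iff, hy, true_and]
  rfl

lemma monotone_surviveProb (v : ℝ≥0) (n : ℕ) : Monotone (surviveProb v n) := by
  intro a b hab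
  refine measure_mono fun z hz k hk => (hz k hk).trans_le ?_
  unfold walk
  gcongr

/-- The upper tail of the sum of `k` independent centered Gaussian steps of variance `v`. -/
def tail (v : ℝ≥0) (k : ℕ) (c : ℝ) : ℝ≥0∞ := gaussianReal 0 (k * v) (Set.Ioi c)

lemma tail_le_one (v : ℝ≥0) (k : ℕ) (c : ℝ) : tail v k c ≤ 1 := prob_le_one

lemma antitone_tail (v : ℝ≥0) (k : ℕ) : Antitone (tail v k) :=
  fun _ _ h => measure_mono (Set.Ioi_subset_Ioi h)

lemma tail_zero (v : ℝ≥0) (c : ℝ) : tail v 0 c = if c < 0 then 1 else 0 := by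
  simp [tail, gaussianReal_zero_var, Set.indicator_apply]

lemma gaussianReal_zero_Iio (v : ℝ≥0) (c : ℝ) :
    gaussianReal 0 v (Set.Iio (-c)) = gaussianReal 0 v (Set.Ioi c) := by
  have h := gaussianReal_map_neg (μ := 0) (v := v)
  rw [neg_zero] at h
  conv_lhs => rw [← h, Measure.map_apply measurable_neg measurableSet_Iio]
  simp

lemma lintegral_gaussianReal_comp_neg (v : ℝ≥0) {f : ℝ → ℝ≥0∞} (hf : Measurable f) :
    ∫⁻ x, f (-x) ∂gaussianReal 0 v = ∫⁻ x, f x ∂gaussianReal 0 v := by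
  have h := gaussianReal_map_neg (μ := 0) (v := v)
  rw [neg_zero] at h
  conv_rhs => rw [← h, lintegral_map hf measurable_neg]

lemma tail_succ (v : ℝ≥0) (k : ℕ) (c : ℝ) :
    tail v (k + 1) c = ∫⁻ x, tail v k (c + x) ∂gaussianReal 0 v := by
  have h := gaussianReal_conv_gaussianReal (m₁ := 0) (m₂ := 0) (v₁ := v) (v₂ := k * v)
  refine Eq.trans ?_ (lintegral_gaussianReal_comp_neg v
    ((antitone_tail v k).measurable.comp (measurable_const_add c)))
  have h2 : ((k + 1 : ℕ) : ℝ≥0) * v = v + k * v := by push_cast; ring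
  rw [add_zero] at h
  rw [tail, h2, ← h, Measure.conv, Measure.map_apply (by fun_prop)
    measurableSet_Ioi, Measure.prod_apply (measurableSet_Ioi.preimage (by fun_prop))]
  refine lintegral_congr fun x => congrArg (gaussianReal 0 (k * v)) ?_
  ext z
  simp only [Set.mem_preimage, Set.mem_Ioi]
  constructor <;> intro h <;> linarith

lemma tail_sub_succ (v : ℝ≥0) (k : ℕ) (c : ℝ) :
    tail v (k + 1) c = ∫⁻ x, tail v k (c - x) ∂gaussianReal 0 v := by
  rw [tail_succ]
  exact (lintegral_gaussianReal_comp_neg v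
    ((antitone_tail v k).measurable.comp (measurable_const_add c))).symm

lemma tail_sub_eq (v : ℝ≥0) (k : ℕ) (c : ℝ) {x : ℝ} (hx : 0 ≤ x) :
    tail v k (c - x) = gaussianReal 0 (k * v) (Set.Ioc (c - x) (c + x)) + tail v k (c + x) := by
  rw [tail, tail, ← measure_union _ measurableSet_Ioi, Set.Ioc_union_Ioi_eq_Ioi (by linarith)]
  exact Set.disjoint_left.2 fun z hz hz' => (not_lt_of_ge hz.2) hz'

/-- The inductive step of the one-sided reflection principle, with an overshoot of size `η`. -/
lemma reflection_step (v : ℝ≥0) (k : ℕ) {h : ℝ → ℝ≥0∞} {C : ℝ≥0∞} {l η : ℝ}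
    (h0 : ∀ y ≤ 0, h y = 0)
    (hk : ∀ y, 0 < y → h y + C * tail v k (l + (y + η))
      ≤ C * tail v k (l - (y + η)) + C * (k * gaussianReal 0 v (Set.Ioi η))) {y : ℝ} (hy0 : 0 < y) :
    ∫⁻ x, h (y + x) ∂gaussianReal 0 v + C * tail v (k + 1) (l + (y + η))
      ≤ C * tail v (k + 1) (l - (y + η))
        + C * ((k + 1 : ℕ) * gaussianReal 0 v (Set.Ioi η)) := by
  have m1 : Measurable fun x => tail v k (l + (y + η) + x) :=
    (antitone_tail v k).measurable.comp (measurable_const_add _)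
  have m2 : Measurable fun x => tail v k (l - (y + η) - x) :=
    (antitone_tail v k).measurable.comp (measurable_const.sub measurable_id)
  set p := gaussianReal 0 v (Set.Ioi η) with hp
  have key : ∀ x, h (y + x) + C * tail v k (l + (y + η) + x)
      ≤ C * tail v k (l - (y + η) - x) + (C * (k * p)
        + C * (Set.Iio (-η)).indicator 1 x) := by
    intro x
    have e1 : l + (y + η) + x = l + (y + x + η) := by ring
    have e2 : l - (y + η) - x = l - (y + x + η) := by ring
    rw [e1, e2]
    rcases lt_or_ge 0 (y + x) with hy | hy
    · exact (hk _ hy).trans (by gcongr; exact le_self_add)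
    · rw [h0 _ hy, zero_add]
      rcases lt_or_ge x (-η) with hx | hx
      · rw [Set.indicator_of_mem (by exact hx)]
        calc C * tail v k (l + (y + x + η)) ≤ C * 1 := by gcongr; exact tail_le_one _ _ _
          _ ≤ _ := by rw [← add_assoc]; exact le_add_self
      · refine le_trans ?_ le_self_add
        gcongr
        exact antitone_tail v k (by linarith)
  rw [tail_succ, tail_sub_succ, ← lintegral_const_mul _ m1, ← lintegral_const_mul _ m2,
    ← lintegral_add_right _ (m1.const_mul C)]
  refine (lintegral_mono key).trans ?_
  rw [lintegral_add_left (m2.const_mul C), lintegral_add_left measurable_const,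
    lintegral_const_mul _ (measurable_one.indicator measurableSet_Iio),
    lintegral_indicator_one measurableSet_Iio, gaussianReal_zero_Iio, lintegral_const,
    measure_univ, mul_one, ← hp]
  push_cast
  gcongr
  rw [← mul_add, add_mul, one_mul]

/-- The probability of one overshoot larger than `η` in a Gaussian step of variance `v`. -/
abbrev bigStep (v : ℝ≥0) (η : ℝ) : ℝ≥0∞ := gaussianReal 0 v (Set.Ioi η)

lemma surviveProb_add_tail_le (v : ℝ≥0) {η : ℝ} (hη : 0 ≤ η) (n : ℕ) :
    ∀ y, 0 < y → surviveProb v n y + 1 * tail v n (0 + (y + η))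
      ≤ 1 * tail v n (0 - (y + η)) + 1 * (n * bigStep v η) := by
  induction n with
  | zero =>
    intro y hy
    rw [tail_zero, tail_zero, if_neg (by linarith), if_pos (by linarith)]
    simpa using surviveProb_le_one v 0 y
  | succ n ih =>
    intro y hy
    rw [surviveProb_succ v n hy]
    exact reflection_step v n (fun y hy => surviveProb_of_nonpos v n hy) ih hy

lemma surviveProb_le (v : ℝ≥0) {η : ℝ} (hη : 0 ≤ η) (n : ℕ) {y : ℝ} (hy : 0 < y) :
    surviveProb v n y
      ≤ gaussianReal 0 (n * v) (Set.Ioc (0 - (y + η)) (0 + (y + η))) + n * bigStep v η := by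
  have h := surviveProb_add_tail_le v hη n y hy
  rw [one_mul, one_mul, one_mul, tail_sub_eq v n 0 (by linarith), add_right_comm] at h
  exact (ENNReal.add_le_add_iff_right ((tail_le_one _ _ _).trans_lt one_lt_top).ne).1 h

lemma tail_le_surviveProb_add (v : ℝ≥0) (n : ℕ) :
    ∀ y, 0 < y → tail v n (0 - y) ≤ surviveProb v n y + tail v n (0 + y) := by
  induction n with
  | zero =>
    intro y hy
    rw [surviveProb_zero v hy]
    exact (tail_le_one _ _ _).trans le_self_add
  | succ n ih =>
    intro y hy
    rw [surviveProb_succ v n hy, tail_sub_succ, tail_succ]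
    refine le_trans ?_ (lintegral_add_right _
      ((antitone_tail v n).measurable.comp (measurable_const_add _))).le
    refine lintegral_mono fun x => ?_
    have e1 : 0 - y - x = 0 - (y + x) := by ring
    simp only [Function.comp_apply]
    rw [e1, add_assoc 0 y x]
    rcases lt_or_ge 0 (y + x) with h | h
    · exact ih _ h
    · exact (antitone_tail v n (by linarith)).trans le_add_self

lemma le_surviveProb (v : ℝ≥0) (n : ℕ) {y : ℝ} (hy : 0 < y) :
    gaussianReal 0 (n * v) (Set.Ioc (0 - y) (0 + y)) ≤ surviveProb v n y := by
  have h := tail_le_surviveProb_add v n y hy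
  rw [tail_sub_eq v n 0 hy.le] at h
  exact (ENNReal.add_le_add_iff_right ((tail_le_one _ _ _).trans_lt one_lt_top).ne).1 h

/-- The increment vectors for which the walk started at `y` exceeds `1` while being positive. -/
def exceedSet (n : ℕ) (y : ℝ) : Set (Fin n → ℝ) :=
  {z | ∃ k ≤ n, 1 < walk y z k ∧ ∀ j ≤ k, 0 < walk y z j}

lemma measurableSet_exceedSet (n : ℕ) (y : ℝ) : MeasurableSet (exceedSet n y) := by
  have : exceedSet n y = ⋃ k, ⋃ (_ : k ≤ n), ({z | 1 < walk y z k} ∩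
      ⋂ j, ⋂ (_ : j ≤ k), {z | 0 < walk y z j}) := by
    ext; simp [exceedSet, and_left_comm]
  rw [this]
  exact MeasurableSet.iUnion fun k => MeasurableSet.iUnion fun _ =>
    (measurableSet_lt measurable_const (measurable_walk_right y k)).inter
      (MeasurableSet.iInter fun k => MeasurableSet.iInter fun _ =>
        measurableSet_lt measurable_const (measurable_walk_right y k))

lemma stepLaw_exceedSet_of_nonpos (v : ℝ≥0) (n : ℕ) {y : ℝ} (hy : y ≤ 0) :
    stepLaw v n (exceedSet n y) = 0 := by
  have : exceedSet n y = ∅ := by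
    refine Set.eq_empty_of_forall_notMem fun z hz => ?_
    obtain ⟨k, -, -, hz⟩ := hz
    have := hz 0 (Nat.zero_le _)
    rw [walk_zero] at this
    linarith
  rw [this, measure_empty]

lemma stepLaw_exceedSet_succ_le (v : ℝ≥0) (n : ℕ) {y : ℝ} (hy : y ≤ 1) :
    stepLaw v (n + 1) (exceedSet (n + 1) y)
      ≤ ∫⁻ x, stepLaw v n (exceedSet n (y + x)) ∂gaussianReal 0 v := by
  rw [stepLaw_succ_apply v n (measurableSet_exceedSet _ _)]
  refine lintegral_mono fun x => measure_mono ?_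
  rintro z ⟨k, hk, h1, h2⟩
  cases k with
  | zero => rw [walk_zero] at h1; linarith
  | succ k =>
    refine ⟨k, by omega, by rwa [walk_cons_succ] at h1, fun j hj => ?_⟩
    have := h2 (j + 1) (by omega)
    rwa [walk_cons_succ] at this

lemma one_le_two_mul_gaussianReal_Ioi (v : ℝ≥0) {c : ℝ} (hc : c < 0) :
    1 ≤ 2 * gaussianReal 0 v (Set.Ioi c) := by
  have h : (Set.univ : Set ℝ) ⊆ Set.Ioi c ∪ Set.Iio (-c) := fun z _ => by
    rcases lt_or_ge c z with h | h
    · exact Or.inl h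
    · exact Or.inr (show z < -c by linarith)
  rw [two_mul]
  nth_rewrite 2 [← gaussianReal_zero_Iio v c]
  rw [← measure_univ (μ := gaussianReal 0 v)]
  exact (measure_mono h).trans (measure_union_le _ _)

lemma gaussianReal_Ioi_le_chebyshev (v : ℝ≥0) {c : ℝ} (hc : 0 < c) :
    gaussianReal 0 v (Set.Ioi c) ≤ ENNReal.ofReal (v / c ^ 2) := by
  have h := meas_ge_le_variance_div_sq (memLp_id_gaussianReal (μ := 0) (v := v) 2) hc
  rw [variance_id_gaussianReal] at h
  refine le_trans (measure_mono fun z (hz : c < z) => ?_) h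
  simp only [id_eq, integral_id_gaussianReal, sub_zero, Set.mem_ofPred_eq]
  exact hz.le.trans (le_abs_self z)

lemma gaussianReal_Ioi_le (v : ℝ≥0) (hv : v ≠ 0) {c : ℝ} (hc : 0 < c) :
    gaussianReal 0 v (Set.Ioi c) ≤ ENNReal.ofReal (8 * v ^ 2 / c ^ 4) := by
  have h : HasSubgaussianMGF id v (gaussianReal 0 v) := by
    refine ⟨fun t => integrable_exp_mul_gaussianReal t, fun t => ?_⟩
    simp [mgf_id_gaussianReal]
  have h1 := h.measure_ge_le hc.le
  have hv' : (0 : ℝ) < v := by positivity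
  have h2 : Real.exp (-c ^ 2 / (2 * v)) ≤ 8 * v ^ 2 / c ^ 4 := by
    have h3 : -c ^ 2 / (2 * (v : ℝ)) = -(c ^ 2 / (2 * v)) := by ring
    have h4 := Real.quadratic_le_exp_of_nonneg (x := c ^ 2 / (2 * v)) (by positivity)
    have h5 : (0 : ℝ) < (c ^ 2 / (2 * v)) ^ 2 / 2 := by positivity
    rw [h3, Real.exp_neg]
    have h6 : 8 * v ^ 2 / c ^ 4 = ((c ^ 2 / (2 * (v : ℝ))) ^ 2 / 2)⁻¹ := by
      field_simp; norm_num
    rw [h6]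
    refine inv_anti₀ h5 (le_trans ?_ h4)
    have : 0 < c ^ 2 / (2 * (v : ℝ)) := by positivity
    linarith
  rw [← ofReal_measureReal]
  refine ENNReal.ofReal_le_ofReal (le_trans ?_ (h1.trans h2))
  exact measureReal_mono fun z (hz : c < z) => hz.le

lemma one_add_tail_le (v : ℝ≥0) (n : ℕ) (hv : n * v ≤ 1) {u : ℝ} (hu : 1 < u) :
    1 + 4 * tail v n (1 + u) ≤ 4 * tail v n (1 - u) := by
  have h1 : 1 ≤ 2 * tail v n (1 - u) := one_le_two_mul_gaussianReal_Ioi _ (by linarith)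
  have h2 : 4 * tail v n (1 + u) ≤ 1 := by
    have h3 : tail v n (1 + u) ≤ ENNReal.ofReal (1 / 4) := by
      refine (antitone_tail v n (show (2 : ℝ) ≤ 1 + u by linarith)).trans
        ((gaussianReal_Ioi_le_chebyshev _ two_pos).trans (ENNReal.ofReal_le_ofReal ?_))
      have : (((n * v : ℝ≥0)) : ℝ) ≤ 1 := by exact_mod_cast hv
      norm_num at this ⊢
      linarith
    calc 4 * tail v n (1 + u) ≤ ENNReal.ofReal 4 * ENNReal.ofReal (1 / 4) := by
          gcongr; simp
      _ = 1 := by rw [← ENNReal.ofReal_mul (by norm_num)]; norm_num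
  calc 1 + 4 * tail v n (1 + u) ≤ 2 * tail v n (1 - u) + 2 * tail v n (1 - u) :=
        add_le_add h1 (h2.trans h1)
    _ = 4 * tail v n (1 - u) := by ring

lemma stepLaw_exceedSet_add_tail_le (v : ℝ≥0) {η : ℝ} (hη : 0 ≤ η) (n : ℕ) (hv : n * v ≤ 1) :
    ∀ y, 0 < y → stepLaw v n (exceedSet n y) + 4 * tail v n (1 + (y + η))
      ≤ 4 * tail v n (1 - (y + η)) + 4 * (n * bigStep v η) := by
  induction n with
  | zero =>
    intro y hy
    rcases lt_or_ge 1 y with h | h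
    · refine (add_le_add_left prob_le_one _).trans ((one_add_tail_le v _ hv ?_).trans le_self_add)
      linarith
    · have : exceedSet 0 y = ∅ := by
        refine Set.eq_empty_of_forall_notMem fun z hz => ?_
        obtain ⟨k, hk, hz, -⟩ := hz
        obtain rfl : k = 0 := by omega
        rw [walk_zero] at hz
        linarith
      rw [this, measure_empty, zero_add]
      refine le_trans ?_ le_self_add
      gcongr
      exact antitone_tail v 0 (by linarith)
  | succ n ih =>
    intro y hy
    rcases lt_or_ge 1 y with h | h
    · refine (add_le_add_left prob_le_one _).trans ((one_add_tail_le v _ hv ?_).trans le_self_add)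
      linarith
    refine (add_le_add_left (stepLaw_exceedSet_succ_le v n h) _).trans ?_
    refine reflection_step v n (fun y hy => stepLaw_exceedSet_of_nonpos v n hy) (ih ?_) hy
    refine le_trans ?_ hv
    gcongr
    simp

lemma stepLaw_exceedSet_le (v : ℝ≥0) {η : ℝ} (hη : 0 ≤ η) (n : ℕ) (hv : n * v ≤ 1) {y : ℝ}
    (hy : 0 < y) :
    stepLaw v n (exceedSet n y)
      ≤ 4 * (gaussianReal 0 (n * v) (Set.Ioc (1 - (y + η)) (1 + (y + η))) + n * bigStep v η) := by
  have h := stepLaw_exceedSet_add_tail_le v hη n hv y hy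
  rw [tail_sub_eq v n 1 (by linarith), mul_add, add_right_comm] at h
  rw [mul_add]
  exact (ENNReal.add_le_add_iff_right
    (ENNReal.mul_lt_top (by simp) ((tail_le_one _ _ _).trans_lt one_lt_top)).ne).1 h

lemma gaussianReal_Ioc_le {v : ℝ≥0} (hv : v ≠ 0) {a b D : ℝ} (hD : 0 ≤ D)
    (h : ∀ x ∈ Set.Ioc a b, gaussianPDFReal 0 v x ≤ D) :
    gaussianReal 0 v (Set.Ioc a b) ≤ ENNReal.ofReal (D * (b - a)) := by
  rw [gaussianReal_apply 0 hv, ENNReal.ofReal_mul hD, ← Real.volume_Ioc]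
  refine (setLIntegral_mono measurable_const fun x hx => ENNReal.ofReal_le_ofReal (h x hx)).trans ?_
  rw [setLIntegral_const]

lemma le_gaussianReal_Ioc {v : ℝ≥0} (hv : v ≠ 0) {a b D : ℝ} (hD : 0 ≤ D)
    (h : ∀ x ∈ Set.Ioc a b, D ≤ gaussianPDFReal 0 v x) :
    ENNReal.ofReal (D * (b - a)) ≤ gaussianReal 0 v (Set.Ioc a b) := by
  rw [gaussianReal_apply 0 hv, ENNReal.ofReal_mul hD, ← Real.volume_Ioc, ← setLIntegral_const]
  exact setLIntegral_mono (measurable_gaussianPDF 0 v) fun x hx => ENNReal.ofReal_le_ofReal (h x hx)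

lemma two_le_sqrt_two_pi_mul {v : ℝ} (hv : 0 ≤ v) :
    2 * Real.sqrt v ≤ Real.sqrt (2 * Real.pi * v) := by
  have : 2 * Real.sqrt v = Real.sqrt (4 * v) := by
    rw [Real.sqrt_mul (by norm_num)]
    congr 1
    rw [show (4 : ℝ) = 2 ^ 2 by norm_num, Real.sqrt_sq (by norm_num)]
  rw [this]
  gcongr
  nlinarith [Real.pi_gt_three]

lemma gaussianPDFReal_le (v : ℝ≥0) (hv : v ≠ 0) (x : ℝ) :
    gaussianPDFReal 0 v x ≤ Real.exp (-x ^ 2 / (2 * v)) / (2 * Real.sqrt v) := by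
  have hv' : (0 : ℝ) < v := by positivity
  have hs : 0 < Real.sqrt v := Real.sqrt_pos.2 hv'
  rw [gaussianPDFReal, sub_zero, inv_mul_eq_div]
  gcongr
  exact two_le_sqrt_two_pi_mul hv'.le

/-- Survival probability of the Gaussian walk: `P(τ > u) ≤ x / √u` up to overshoot. -/
lemma surviveProb_le_sqrt (v : ℝ≥0) (hv : v ≠ 0) {y : ℝ} (hy : 0 < y) (n : ℕ) (hn : n ≠ 0) :
    surviveProb v n y
      ≤ ENNReal.ofReal (2 * y / Real.sqrt (n * v)) + n * bigStep v y := by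
  refine (surviveProb_le v hy.le n hy).trans (add_le_add_left ?_ _)
  have hnv : (n * v : ℝ≥0) ≠ 0 := mul_ne_zero (by exact_mod_cast hn) hv
  have hnv' : (0 : ℝ) < (n * v : ℝ≥0) := by positivity
  have hs : 0 < Real.sqrt (n * v : ℝ≥0) := Real.sqrt_pos.2 hnv'
  refine (gaussianReal_Ioc_le hnv (D := 1 / (2 * Real.sqrt (n * v : ℝ≥0))) (by positivity)
    fun x _ => (gaussianPDFReal_le _ hnv x).trans ?_).trans (ENNReal.ofReal_le_ofReal ?_)
  · gcongr
    rw [Real.exp_le_one_iff, neg_div]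
    have : 0 ≤ x ^ 2 / (2 * ((n * v : ℝ≥0) : ℝ)) := by positivity
    linarith
  · push_cast at hs ⊢
    field_simp
    linarith

lemma stepLaw_exceedSet_le_sqrt (v : ℝ≥0) (hv : v ≠ 0) {y : ℝ} (hy : 0 < y) (hy' : y ≤ 1 / 4)
    (n : ℕ) (hn : n ≠ 0) (hnv1 : n * v ≤ 1) :
    stepLaw v n (exceedSet n y)
      ≤ 4 * (ENNReal.ofReal (16 * y * Real.sqrt (n * v)) + n * bigStep v y) := by
  refine (stepLaw_exceedSet_le v hy.le n hnv1 hy).trans (mul_le_mul_right (add_le_add_left ?_ _) _)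
  have hnv : (n * v : ℝ≥0) ≠ 0 := mul_ne_zero (by exact_mod_cast hn) hv
  have hnv' : (0 : ℝ) < (n * v : ℝ≥0) := by positivity
  have hs : 0 < Real.sqrt (n * v : ℝ≥0) := Real.sqrt_pos.2 hnv'
  have hsq := Real.sq_sqrt hnv'.le
  set u : ℝ≥0 := n * v with hu
  refine (gaussianReal_Ioc_le hnv (D := (8 * u) / (2 * Real.sqrt u)) (by positivity)
    fun x hx => (gaussianPDFReal_le _ hnv x).trans ?_).trans (ENNReal.ofReal_le_ofReal ?_)
  · gcongr
    have hx' : (1 / 2 : ℝ) ≤ x := by have := hx.1; linarith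
    have h1 : -x ^ 2 / (2 * (u : ℝ)) ≤ -(1 / (8 * u)) := by
      rw [neg_div, neg_le_neg_iff, div_le_div_iff₀ (by positivity) (by positivity)]
      have : 1 / 4 ≤ x ^ 2 := by nlinarith
      nlinarith
    refine (Real.exp_le_exp.2 h1).trans ?_
    rw [Real.exp_neg, inv_le_comm₀ (Real.exp_pos _) (by positivity)]
    have := Real.add_one_le_exp (1 / (8 * (u : ℝ)))
    rw [one_div] at this
    rw [one_div]
    linarith
  · have e : ((n : ℝ) * (v : ℝ)) = (u : ℝ) := by rw [hu]; push_cast; rfl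
    rw [e]
    field_simp
    rw [hsq]
    linarith

/-- Survival up to time `2` has probability at least of the order of the starting point. -/
lemma le_surviveProb_two (v : ℝ≥0) (n : ℕ) (hnv : n * v = 2) {y : ℝ} (hy : 0 < y) (hy' : y ≤ 1) :
    ENNReal.ofReal (gaussianPDFReal 0 2 1 * (2 * y)) ≤ surviveProb v n y := by
  refine le_trans ?_ (le_surviveProb v n hy)
  rw [hnv, show 2 * y = (0 + y) - (0 - y) by ring]
  refine le_gaussianReal_Ioc two_ne_zero (gaussianPDFReal_nonneg _ _ _) fun x hx => ?_
  unfold gaussianPDFReal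
  have : x ^ 2 ≤ 1 := by nlinarith [hx.1, hx.2]
  refine mul_le_mul_of_nonneg_left (Real.exp_le_exp.2 ?_) (by positivity)
  exact div_le_div_of_nonneg_right (by linarith) (by positivity)

/-- The increment vectors for which the positive walk is below `b` at a time in `[m, M]`. -/
def lowSet (n m M : ℕ) (y b : ℝ) : Set (Fin n → ℝ) :=
  {z | z ∈ surviveSet n y ∧ ∃ j ≤ M, m ≤ j ∧ walk y z j < b}

lemma measurableSet_lowSet (n m M : ℕ) (y b : ℝ) : MeasurableSet (lowSet n m M y b) := by
  have : lowSet n m M y b = surviveSet n y ∩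
      ⋃ j, ⋃ (_ : j ≤ M), ⋃ (_ : m ≤ j), {z | walk y z j < b} := by
    ext; simp [lowSet, and_left_comm]
  rw [this]
  exact (measurableSet_surviveSet n y).inter (MeasurableSet.iUnion fun j =>
    MeasurableSet.iUnion fun _ => MeasurableSet.iUnion fun _ =>
      measurableSet_lt (measurable_walk_right y j) measurable_const)

/-- The Markov property at the first passage below `b` after time `m`. -/
lemma stepLaw_lowSet_le (v : ℝ≥0) (b : ℝ) (L K : ℕ) (B : ℝ≥0∞)
    (hB : ∀ k, L ≤ k → k ≤ K → ∀ y < b, surviveProb v k y ≤ B) (n : ℕ) (hnK : n ≤ K) :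
    ∀ (m M : ℕ) (y : ℝ), L + M ≤ n → stepLaw v n (lowSet n m M y b) ≤ surviveProb v m y * B := by
  induction n with
  | zero =>
    intro m M y hn
    rcases Set.eq_empty_or_nonempty (lowSet 0 m M y b) with h | ⟨z, hz, j, hj, hmj, hjb⟩
    · rw [h, measure_empty]; exact zero_le
    · obtain rfl : j = 0 := by omega
      obtain rfl : m = 0 := by omega
      have h0 := hz 0 le_rfl
      rw [walk_zero] at hjb h0
      rw [surviveProb_zero v h0, one_mul]
      exact (measure_mono fun z hz => hz.1).trans (hB 0 (by omega) hnK y hjb)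
  | succ n ih =>
    intro m M y hn
    rcases le_or_gt y 0 with hy | hy
    · refine (measure_mono fun z hz => hz.1).trans ?_
      exact (surviveProb_of_nonpos v (n + 1) hy).le.trans zero_le
    by_cases hmb : m = 0 ∧ y < b
    · obtain ⟨rfl, hyb⟩ := hmb
      rw [surviveProb_zero v hy, one_mul]
      exact (measure_mono fun z hz => hz.1).trans (hB (n + 1) (by omega) hnK y hyb)
    cases M with
    | zero =>
      have : lowSet (n + 1) m 0 y b = ∅ := by
        refine Set.eq_empty_of_forall_notMem ?_
        rintro z ⟨-, j, hj, hmj, hjb⟩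
        obtain rfl : j = 0 := by omega
        rw [walk_zero] at hjb
        exact hmb ⟨by omega, hjb⟩
      rw [this, measure_empty]
      exact zero_le
    | succ M =>
      have step : stepLaw v (n + 1) (lowSet (n + 1) m (M + 1) y b)
          ≤ ∫⁻ x, surviveProb v (m - 1) (y + x) * B ∂gaussianReal 0 v := by
        rw [stepLaw_succ_apply v n (measurableSet_lowSet _ _ _ _ _)]
        refine lintegral_mono fun x =>
          (measure_mono ?_).trans (ih (by omega) (m - 1) M (y + x) (by omega))
        rintro z ⟨hz, j, hj, hmj, hjb⟩
        refine ⟨(cons_mem_surviveSet_iff.1 hz).2, ?_⟩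
        cases j with
        | zero =>
          rw [walk_zero] at hjb
          exact absurd ⟨by omega, hjb⟩ hmb
        | succ j => exact ⟨j, by omega, by omega, by rwa [walk_cons_succ] at hjb⟩
      refine step.trans ?_
      refine (lintegral_mul_const _ ((monotone_surviveProb v _).measurable.comp
        (measurable_const_add y))).le.trans ?_
      gcongr
      simp only [Function.comp_apply]
      cases m with
      | zero =>
        rw [surviveProb_zero v hy]
        refine (lintegral_mono fun x => surviveProb_le_one v _ _).trans ?_
        simp
      | succ m => rw [surviveProb_succ v m hy, Nat.add_sub_cancel]

/-- The increment vectors for which the walk exceeds `a` in absolute value before time `M`. -/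
def maxSet (n M : ℕ) (y a : ℝ) : Set (Fin n → ℝ) := {z | ∃ k ≤ M, a < |walk y z k|}

lemma measurableSet_maxSet (n M : ℕ) (y a : ℝ) : MeasurableSet (maxSet n M y a) := by
  have : maxSet n M y a = ⋃ k, ⋃ (_ : k ≤ M), {z | a < |walk y z k|} := by
    ext; simp [maxSet]
  rw [this]
  exact MeasurableSet.iUnion fun k => MeasurableSet.iUnion fun _ =>
    measurableSet_lt measurable_const (measurable_walk_right y k).abs

lemma lintegral_sq_gaussianReal (v : ℝ≥0) (y c : ℝ) (hc : 0 ≤ c) (a : ℝ) :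
    ∫⁻ x, ENNReal.ofReal (((y + x) ^ 2 + c) / a ^ 2) ∂gaussianReal 0 v
      = ENNReal.ofReal ((y ^ 2 + v + c) / a ^ 2) := by
  have hL : MemLp (fun x : ℝ => x) 2 (gaussianReal 0 v) := memLp_id_gaussianReal 2
  have i2 : Integrable (fun x : ℝ => x ^ 2) (gaussianReal 0 v) := hL.integrable_sq
  have i1 : Integrable (fun x : ℝ => x) (gaussianReal 0 v) := hL.integrable one_le_two
  have h2 : ∫ x, x ^ 2 ∂gaussianReal 0 v = v := by
    have := variance_eq_sub hL
    rw [variance_fun_id_gaussianReal, integral_id_gaussianReal] at this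
    simpa using this.symm
  have e : ∀ x : ℝ, ((y + x) ^ 2 + c) / a ^ 2
      = (y ^ 2 + c + (2 * y) * x + x ^ 2) / a ^ 2 := fun x => by ring
  have i3 : Integrable (fun x : ℝ => y ^ 2 + c + (2 * y) * x) (gaussianReal 0 v) :=
    (integrable_const _).add (i1.const_mul _)
  rw [← ofReal_integral_eq_lintegral_ofReal]
  · simp_rw [e]
    rw [integral_div, integral_add i3 i2, integral_add (integrable_const _) (i1.const_mul _),
      integral_const_mul, integral_id_gaussianReal, h2]
    congr 2
    simp
    ring
  · simp_rw [e]
    exact (i3.add i2).div_const _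
  · exact Eventually.of_forall fun x => by positivity

/-- Kolmogorov's maximal inequality for the Gaussian walk. -/
lemma stepLaw_maxSet_le (v : ℝ≥0) {a : ℝ} (ha : 0 < a) (n : ℕ) :
    ∀ (M : ℕ) (y : ℝ),
      stepLaw v n (maxSet n M y a) ≤ ENNReal.ofReal ((y ^ 2 + M * v) / a ^ 2) := by
  have big : ∀ (M : ℕ) (y : ℝ), a < |y| → (1 : ℝ≥0∞) ≤ ENNReal.ofReal ((y ^ 2 + M * v) / a ^ 2) := by
    intro M y hy
    rw [ENNReal.one_le_ofReal, one_le_div (by positivity)]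
    have h1 : a ^ 2 ≤ y ^ 2 := by rw [← sq_abs y]; gcongr
    have : 0 ≤ (M : ℝ) * v := by positivity
    linarith
  induction n with
  | zero =>
    intro M y
    rcases Set.eq_empty_or_nonempty (maxSet 0 M y a) with h | ⟨z, k, hk, hz⟩
    · rw [h, measure_empty]; exact zero_le
    · exact prob_le_one.trans (big M y (by simpa [walk] using hz))
  | succ n ih =>
    intro M y
    rcases lt_or_ge a |y| with hy | hy
    · exact prob_le_one.trans (big M y hy)
    cases M with
    | zero =>
      have : maxSet (n + 1) 0 y a = ∅ := by
        refine Set.eq_empty_of_forall_notMem ?_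
        rintro z ⟨k, hk, hz⟩
        obtain rfl : k = 0 := by omega
        rw [walk_zero] at hz
        linarith
      rw [this, measure_empty]
      exact zero_le
    | succ M =>
      rw [stepLaw_succ_apply v n (measurableSet_maxSet _ _ _ _)]
      refine (lintegral_mono fun x => (measure_mono ?_).trans (ih M (y + x))).trans ?_
      · rintro z ⟨k, hk, hz⟩
        cases k with
        | zero => rw [walk_zero] at hz; linarith
        | succ k => exact ⟨k, by omega, by rwa [walk_cons_succ] at hz⟩
      · rw [lintegral_sq_gaussianReal v y _ (by positivity)]
        refine ENNReal.ofReal_le_ofReal (le_of_eq ?_)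
        push_cast
        ring

lemma pi_prod_map_column {n D : ℕ} (μ : Measure ℝ) [IsProbabilityMeasure μ] (j : Fin D) :
    (Measure.pi fun _ : Fin n × Fin D => μ).map (fun f i => f (i, j))
      = Measure.pi fun _ : Fin n => μ := by
  have h : iIndepFun (fun (p : Fin n × Fin D) (f : Fin n × Fin D → ℝ) => f p)
      (Measure.pi fun _ => μ) := iIndepFun_pi (X := fun _ => id) fun _ => aemeasurable_id
  have h' := h.precomp (g := fun i : Fin n => (i, j)) (Prod.mk_left_injective j)
  rw [iIndepFun_iff_map_fun_eq_pi_map fun i => (measurable_pi_apply _).aemeasurable] at h'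
  refine h'.trans (congrArg Measure.pi (funext fun i => ?_))
  exact (measurePreserving_eval (fun _ : Fin n × Fin D => μ) (i, j)).map_eq

lemma pi_prod_indepFun_column {n D : ℕ} (μ : Measure ℝ) [IsProbabilityMeasure μ] {j l : Fin D}
    (hjl : j ≠ l) :
    IndepFun (fun (f : Fin n × Fin D → ℝ) i => f (i, j)) (fun f i => f (i, l))
      (Measure.pi fun _ : Fin n × Fin D => μ) := by
  have h : iIndepFun (fun (p : Fin n × Fin D) (f : Fin n × Fin D → ℝ) => f p)
      (Measure.pi fun _ => μ) := iIndepFun_pi (X := fun _ => id) fun _ => aemeasurable_id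
  have h' := h.indepFun_finset (Finset.univ.image fun i => (i, j))
    (Finset.univ.image fun i => (i, l)) (by
      rw [Finset.disjoint_left]
      simp only [Finset.mem_image, Finset.mem_univ, true_and]
      rintro _ ⟨i, rfl⟩ ⟨k, hk⟩
      exact hjl (congrArg Prod.snd hk).symm) (fun p => measurable_pi_apply p)
  exact h'.comp
    (φ := fun g (i : Fin n) => g ⟨(i, j), by simp⟩)
    (ψ := fun g (i : Fin n) => g ⟨(i, l), by simp⟩)
    (measurable_pi_lambda _ fun i => measurable_pi_apply _)
    (measurable_pi_lambda _ fun i => measurable_pi_apply _)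

/-- The increments of the `j`-th coordinate of a path along the grid of mesh `δ`. -/
def gridIncrement {d : ℕ} (n : ℕ) (δ : ℝ≥0) (j : Fin d) (w : PathSpace d) : Fin n → ℝ :=
  fun i => w (((i : ℕ) + 1 : ℕ) * δ) j - w ((i : ℕ) * δ) j

lemma measurable_eval_coord {d : ℕ} (t : ℝ≥0) (j : Fin d) :
    Measurable fun w : PathSpace d => w t j := by
  have : Continuous fun w : PathSpace d => w t j :=
    (EuclideanSpace.proj j : E d →L[ℝ] ℝ).continuous.comp (continuous_eval_const t)
  exact this.measurable

lemma measurable_gridIncrement {d : ℕ} (n : ℕ) (δ : ℝ≥0) (j : Fin d) :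
    Measurable (gridIncrement (d := d) n δ j) :=
  measurable_pi_lambda _ fun _ => (measurable_eval_coord _ _).sub (measurable_eval_coord _ _)

lemma IsWiener.map_increments {d : ℕ} {W : E d → Measure (PathSpace d)} (hW : IsWiener W)
    (x : E d) (n : ℕ) (δ : ℝ≥0) :
    (W x).map (fun w (p : Fin n × Fin d) => gridIncrement n δ p.2 w p.1)
      = Measure.pi fun _ => gaussianReal 0 δ := by
  have h := (hW x).2.2 n (fun i => (i : ℕ) * δ) (fun i k hik => by
    have : (i : ℕ) ≤ k := hik
    dsimp only
    gcongr)
  refine (Eq.trans ?_ h).trans (congrArg Measure.pi (funext fun p => ?_))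
  · rfl
  · congr 1
    simp [add_mul]

lemma IsWiener.measure_gridIncrement {d : ℕ} {W : E d → Measure (PathSpace d)} (hW : IsWiener W)
    (x : E d) (n : ℕ) (δ : ℝ≥0) (j : Fin d) {A : Set (Fin n → ℝ)} (hA : MeasurableSet A) :
    W x {w | gridIncrement n δ j w ∈ A} = stepLaw δ n A := by
  have hm : Measurable fun (w : PathSpace d) (p : Fin n × Fin d) => gridIncrement n δ p.2 w p.1 :=
    measurable_pi_lambda _ fun p => (measurable_pi_apply p.1).comp (measurable_gridIncrement _ _ _)
  have hc : Measurable fun (f : Fin n × Fin d → ℝ) (i : Fin n) => f (i, j) := by fun_prop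
  rw [stepLaw, ← pi_prod_map_column (gaussianReal 0 δ) j, ← hW.map_increments x n δ,
    Measure.map_map hc hm, Measure.map_apply (hc.comp hm) hA]
  rfl

lemma IsWiener.measure_gridIncrement_inter {d : ℕ} {W : E d → Measure (PathSpace d)}
    (hW : IsWiener W) (x : E d) (n : ℕ) (δ : ℝ≥0) {j l : Fin d} (hjl : j ≠ l)
    {A B : Set (Fin n → ℝ)} (hA : MeasurableSet A) (hB : MeasurableSet B) :
    W x {w | gridIncrement n δ j w ∈ A ∧ gridIncrement n δ l w ∈ B}
      = stepLaw δ n A * stepLaw δ n B := by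
  have hm : Measurable fun (w : PathSpace d) (p : Fin n × Fin d) => gridIncrement n δ p.2 w p.1 :=
    measurable_pi_lambda _ fun p => (measurable_pi_apply p.1).comp (measurable_gridIncrement _ _ _)
  have hc : ∀ j, Measurable fun (f : Fin n × Fin d → ℝ) (i : Fin n) => f (i, j) := by
    intro j; fun_prop
  have h := (pi_prod_indepFun_column (n := n) (gaussianReal 0 δ) hjl).measure_inter_preimage_eq_mul
    A B hA hB
  rw [← Measure.map_apply (hc j) hA, ← Measure.map_apply (hc l) hB, pi_prod_map_column,
    pi_prod_map_column, ← hW.map_increments x n δ,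
    Measure.map_apply hm ((hc j hA).inter (hc l hB))] at h
  exact h

lemma walk_gridIncrement {d : ℕ} {n : ℕ} (δ : ℝ≥0) (j : Fin d) (w : PathSpace d) (y : ℝ) {k : ℕ}
    (hk : k ≤ n) : walk y (gridIncrement n δ j w) k = y + (w (k * δ) j - w 0 j) := by
  induction k with
  | zero => simp
  | succ k ih =>
    have := walk_succ y (gridIncrement n δ j w) ⟨k, hk⟩
    simp only at this
    rw [this, ih (by omega)]
    simp only [gridIncrement]
    ring

/-- An event that eventually implies `s N` has measure at most the limit of bounds on `s N`. -/
lemma measure_le_of_eventually_mem {α : Type*} [MeasurableSpace α] (μ : Measure α) {A : Set α}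
    {s : ℕ → Set α} {c : ℕ → ℝ≥0∞} {c0 : ℝ≥0∞} (hA : ∀ w ∈ A, ∀ᶠ N in atTop, w ∈ s N)
    (hs : ∀ᶠ N in atTop, μ (s N) ≤ c N) (hc : Tendsto c atTop (𝓝 c0)) : μ A ≤ c0 := by
  have hsub : A ⊆ ⋃ m, ⋂ N, ⋂ (_ : m ≤ N), s N := fun w hw => by
    obtain ⟨m, hm⟩ := eventually_atTop.1 (hA w hw)
    exact Set.mem_iUnion.2 ⟨m, Set.mem_iInter₂.2 hm⟩
  have hmono : Monotone fun m => ⋂ N, ⋂ (_ : m ≤ N), s N := fun a b hab =>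
    Set.subset_iInter₂ fun N hN => Set.iInter₂_subset N (hab.trans hN)
  refine (measure_mono hsub).trans ?_
  rw [hmono.measure_iUnion]
  refine iSup_le fun m => ge_of_tendsto hc ?_
  filter_upwards [hs, eventually_ge_atTop m] with N h1 h2
  exact (measure_mono (Set.iInter₂_subset N h2)).trans h1

/-- The mesh of the `N`-th grid. -/
def mesh (N : ℕ) : ℝ≥0 := (16 ^ N)⁻¹

lemma mesh_ne_zero (N : ℕ) : mesh N ≠ 0 := by simp [mesh]

lemma mesh_eq {l N : ℕ} (h : l ≤ N) : mesh l = (16 ^ (N - l) : ℕ) * mesh N := by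
  obtain ⟨c, rfl⟩ := Nat.exists_eq_add_of_le h
  rw [Nat.add_sub_cancel_left]
  simp only [mesh]
  push_cast
  rw [pow_add]
  field_simp

lemma mesh_mul_pow (N : ℕ) : ((16 ^ N : ℕ) : ℝ≥0) * mesh N = 1 := by
  have := mesh_eq (Nat.zero_le N)
  rw [Nat.sub_zero] at this
  rw [← this]; simp [mesh]

lemma sqrt_mesh (N : ℕ) : Real.sqrt (mesh N) = (4 ^ N)⁻¹ := by
  have : ((mesh N : ℝ≥0) : ℝ) = ((4 ^ N)⁻¹) ^ 2 := by
    simp only [mesh]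
    push_cast
    rw [inv_pow, ← pow_mul, mul_comm, pow_mul]
    norm_num
  rw [this, Real.sqrt_sq (by positivity)]

lemma tendsto_mesh : Tendsto (fun N => (mesh N : ℝ)) atTop (𝓝 0) := by
  have : (fun N => (mesh N : ℝ)) = fun N => ((16 : ℝ)⁻¹) ^ N := by
    funext N; simp [mesh]
  rw [this]
  exact tendsto_pow_atTop_nhds_zero_of_lt_one (by norm_num) (by norm_num)

/-- The index of the last point of the `N`-th grid before `t`. -/
def gridIndex (t : ℝ≥0) (N : ℕ) : ℕ := ⌊t * 16 ^ N⌋₊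

lemma gridIndex_mul_le (t : ℝ≥0) (N : ℕ) : (gridIndex t N : ℝ≥0) * mesh N ≤ t := by
  rw [mesh, ← div_eq_mul_inv, div_le_iff₀ (by positivity)]
  exact Nat.floor_le zero_le

lemma tendsto_gridIndex_mul (t : ℝ≥0) :
    Tendsto (fun N => (gridIndex t N : ℝ≥0) * mesh N) atTop (𝓝 t) := by
  rw [← NNReal.tendsto_coe]
  have h : Tendsto (fun N => (t : ℝ) - mesh N) atTop (𝓝 t) := by
    simpa using tendsto_const_nhds.sub tendsto_mesh
  refine tendsto_of_tendsto_of_tendsto_of_le_of_le h tendsto_const_nhds (fun N => ?_)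
    fun N => by exact_mod_cast gridIndex_mul_le t N
  have h1 : t * 16 ^ N ≤ gridIndex t N + 1 := (Nat.lt_floor_add_one _).le
  have h2 : (t : ℝ) * 16 ^ N ≤ gridIndex t N + 1 := by exact_mod_cast h1
  simp only [mesh]
  push_cast
  rw [sub_le_iff_le_add, ← add_one_mul, ← div_eq_mul_inv, le_div_iff₀ (by positivity)]
  exact h2

lemma pow_le_gridIndex {t : ℝ≥0} {l N : ℕ} (hl : l ≤ N) (ht : mesh l ≤ t) :
    16 ^ (N - l) ≤ gridIndex t N := by
  refine Nat.le_floor ?_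
  rw [mesh_eq hl, mesh, ← div_eq_mul_inv, div_le_iff₀ (by positivity)] at ht
  exact ht

lemma gridIndex_le_of_le_mul {t : ℝ≥0} {N c : ℕ} (ht : t ≤ c * mesh N) : gridIndex t N ≤ c := by
  have h := (gridIndex_mul_le t N).trans ht
  have := le_of_mul_le_mul_right h (pos_iff_ne_zero.2 (mesh_ne_zero N))
  exact_mod_cast this

lemma tendsto_eval_gridIndex {d : ℕ} (w : PathSpace d) (t : ℝ≥0) (j : Fin d) :
    Tendsto (fun N => w ((gridIndex t N : ℝ≥0) * mesh N) j) atTop (𝓝 (w t j)) := by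
  have : Continuous fun s => w s j :=
    (EuclideanSpace.proj j : E d →L[ℝ] ℝ).continuous.comp w.continuous
  exact (this.tendsto t).comp (tendsto_gridIndex_mul t)

lemma tendsto_pow_mul_bigStep {η : ℝ} (hη : 0 < η) :
    Tendsto (fun N => ((16 ^ N : ℕ) : ℝ≥0∞) * bigStep (mesh N) η) atTop (𝓝 0) := by
  have h : Tendsto (fun N => ENNReal.ofReal (8 * mesh N / η ^ 4)) atTop (𝓝 0) := by
    rw [← ENNReal.ofReal_zero]
    refine ENNReal.tendsto_ofReal ?_
    simpa using (tendsto_mesh.const_mul 8).div_const (η ^ 4)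
  refine tendsto_of_tendsto_of_tendsto_of_le_of_le tendsto_const_nhds h (fun N => zero_le)
    fun N => ?_
  dsimp only
  calc ((16 ^ N : ℕ) : ℝ≥0∞) * bigStep (mesh N) η
      ≤ ENNReal.ofReal ((16 ^ N : ℕ) : ℝ) * ENNReal.ofReal (8 * mesh N ^ 2 / η ^ 4) := by
        rw [ENNReal.ofReal_natCast]
        gcongr
        exact gaussianReal_Ioi_le _ (mesh_ne_zero N) hη
    _ = ENNReal.ofReal (8 * mesh N / η ^ 4) := by
        rw [← ENNReal.ofReal_mul (by positivity)]
        congr 1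
        have : ((16 ^ N : ℕ) : ℝ) * mesh N = 1 := by exact_mod_cast mesh_mul_pow N
        calc _ = (((16 ^ N : ℕ) : ℝ) * mesh N) * (8 * mesh N / η ^ 4) := by ring
          _ = _ := by rw [this, one_mul]

section Paths

variable {d : ℕ} {W : E (d + 2) → Measure (PathSpace (d + 2))}

lemma gridIncrement_mem_surviveSet {w : PathSpace (d + 2)} {T : ℝ≥0}
    (hw : ∀ t ≤ T, 0 < w t 0) {n : ℕ} {δ : ℝ≥0} (hT : n * δ ≤ T) {y : ℝ} (hy : w 0 0 = y) :
    gridIncrement n δ 0 w ∈ surviveSet n y := by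
  intro k hk
  rw [walk_gridIncrement δ 0 w y hk, hy, add_sub_cancel]
  refine hw _ (le_trans ?_ hT)
  gcongr

/-- The path is at `x` at time `0` and its first coordinate stays positive up to time `1`. -/
def positivePaths (x : E (d + 2)) : Set (PathSpace (d + 2)) :=
  {w | w 0 = x ∧ ∀ t ≤ 1, 0 < w t 0}

lemma surviveProb_mesh_le {y : ℝ} (hy : 0 < y) {l N : ℕ} (hl : l ≤ N) :
    surviveProb (mesh N) (16 ^ (N - l)) y
      ≤ ENNReal.ofReal (2 * y * 4 ^ l) + (16 ^ N : ℕ) * bigStep (mesh N) y := by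
  refine (surviveProb_le_sqrt _ (mesh_ne_zero N) hy _ (by positivity)).trans ?_
  have h : (((16 ^ (N - l) : ℕ) : ℝ) * (mesh N : ℝ)) = mesh l := by
    exact_mod_cast (mesh_eq hl).symm
  rw [h, sqrt_mesh, div_inv_eq_mul]
  gcongr
  · norm_num
  · omega

lemma measure_low_le (hW : IsWiener W) (x : E (d + 2)) (hx : 0 < x 0) {k : ℕ} (hk : 1 ≤ k)
    {b : ℝ} (hb : 0 < b) :
    W x (positivePaths x ∩ {w | ∃ t, mesh (k + 1) ≤ t ∧ t ≤ mesh k ∧ w t 0 < b})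
      ≤ ENNReal.ofReal (2 * x 0 * 4 ^ (k + 1)) * ENNReal.ofReal (4 * b) := by
  refine measure_le_of_eventually_mem (W x)
    (s := fun N => {w | gridIncrement (16 ^ N) (mesh N) 0 w
      ∈ lowSet (16 ^ N) (16 ^ (N - (k + 1))) (16 ^ (N - k)) (x 0) b})
    (c := fun N => (ENNReal.ofReal (2 * x 0 * 4 ^ (k + 1))
        + (16 ^ N : ℕ) * bigStep (mesh N) (x 0))
      * (ENNReal.ofReal (4 * b) + (16 ^ N : ℕ) * bigStep (mesh N) b)) ?_ ?_ ?_
  · rintro w ⟨⟨hw0, hw⟩, t, ht1, ht2, htb⟩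
    filter_upwards [(tendsto_eval_gridIndex w t 0).eventually_lt_const htb,
      eventually_ge_atTop (k + 1)] with N hN hkN
    refine ⟨gridIncrement_mem_surviveSet hw (mesh_mul_pow N).le (by rw [hw0]),
      gridIndex t N, gridIndex_le_of_le_mul (by rwa [← mesh_eq (by omega)]),
      pow_le_gridIndex hkN ht1, ?_⟩
    rw [walk_gridIncrement, hw0, add_sub_cancel]
    · exact hN
    · refine gridIndex_le_of_le_mul ?_
      rw [mesh_mul_pow]
      exact ht2.trans (inv_le_one_of_one_le₀ (one_le_pow₀ (by norm_num)))
  · filter_upwards [eventually_ge_atTop (k + 1)] with N hkN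
    rw [hW.measure_gridIncrement x _ _ _ (measurableSet_lowSet _ _ _ _ _)]
    have hpow : 16 * 16 ^ (N - k) ≤ 16 ^ N := by
      rw [← pow_succ']
      exact Nat.pow_le_pow_right (by norm_num) (by omega)
    refine (stepLaw_lowSet_le (mesh N) b (16 ^ N - 16 ^ (N - k)) (16 ^ N)
      (ENNReal.ofReal (4 * b) + (16 ^ N : ℕ) * bigStep (mesh N) b) ?_ (16 ^ N) le_rfl _ _ _
      (by omega)).trans (mul_le_mul_left (surviveProb_mesh_le hx hkN) _)
    intro j hj1 hj2 y hy
    have hN0 : 0 < 16 ^ N := by positivity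
    have hj4 : 16 ^ N ≤ 4 * j := by omega
    refine (monotone_surviveProb _ j hy.le).trans
      ((surviveProb_le_sqrt _ (mesh_ne_zero N) hb j (by omega)).trans ?_)
    have h1 : (1 / 4 : ℝ) ≤ j * mesh N := by
      have h2 : ((16 ^ N : ℕ) : ℝ) * mesh N = 1 := by exact_mod_cast mesh_mul_pow N
      have h3 : ((16 ^ N : ℕ) : ℝ) ≤ 4 * j := by exact_mod_cast hj4
      have h4 : (0 : ℝ) ≤ mesh N := NNReal.coe_nonneg _
      nlinarith
    have h5 : (1 / 2 : ℝ) ≤ Real.sqrt (j * mesh N) := by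
      rw [Real.le_sqrt (by norm_num) (by positivity)]
      norm_num at h1 ⊢
      exact h1
    gcongr
    rw [div_le_iff₀ (by linarith)]
    nlinarith
  · have h1 := (tendsto_pow_mul_bigStep hx).const_add (ENNReal.ofReal (2 * x 0 * 4 ^ (k + 1)))
    have h2 := (tendsto_pow_mul_bigStep hb).const_add (ENNReal.ofReal (4 * b))
    rw [add_zero] at h1 h2
    exact ENNReal.Tendsto.mul h1 (Or.inr ofReal_ne_top) h2 (Or.inr ofReal_ne_top)

lemma measure_exceed_le (hW : IsWiener W) (x : E (d + 2)) (hx : 0 < x 0) (hx' : x 0 ≤ 1 / 4)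
    (K : ℕ) :
    W x (positivePaths x ∩ {w | ∃ t ≤ mesh K, 1 < w t 0})
      ≤ 4 * ENNReal.ofReal (16 * x 0 * (4 ^ K)⁻¹) := by
  have hK1 : mesh K ≤ 1 := inv_le_one_of_one_le₀ (one_le_pow₀ (by norm_num))
  refine measure_le_of_eventually_mem (W x)
    (s := fun N => {w | gridIncrement (16 ^ (N - K)) (mesh N) 0 w
      ∈ exceedSet (16 ^ (N - K)) (x 0)})
    (c := fun N => 4 * (ENNReal.ofReal (16 * x 0 * (4 ^ K)⁻¹)
        + (16 ^ N : ℕ) * bigStep (mesh N) (x 0))) ?_ ?_ ?_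
  · rintro w ⟨⟨hw0, hw⟩, t, ht, ht1⟩
    filter_upwards [(tendsto_eval_gridIndex w t 0).eventually_const_lt ht1,
      eventually_ge_atTop K] with N hN hKN
    have hle : gridIndex t N ≤ 16 ^ (N - K) := gridIndex_le_of_le_mul (by rwa [← mesh_eq hKN])
    refine ⟨gridIndex t N, hle, ?_, fun j hj => ?_⟩
    · rw [walk_gridIncrement _ _ _ _ hle, hw0, add_sub_cancel]
      exact hN
    · exact gridIncrement_mem_surviveSet hw ((mesh_eq hKN).symm.le.trans hK1) (by rw [hw0]) j
        (hj.trans hle)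
  · filter_upwards [eventually_ge_atTop K] with N hKN
    rw [hW.measure_gridIncrement x _ _ _ (measurableSet_exceedSet _ _)]
    refine (stepLaw_exceedSet_le_sqrt _ (mesh_ne_zero N) hx hx' _ (by positivity)
      ((mesh_eq hKN).symm.le.trans hK1)).trans ?_
    have h : (((16 ^ (N - K) : ℕ) : ℝ) * (mesh N : ℝ)) = mesh K := by
      exact_mod_cast (mesh_eq hKN).symm
    rw [h, sqrt_mesh]
    gcongr
    · norm_num
    · omega
  · have h1 := (tendsto_pow_mul_bigStep hx).const_add (ENNReal.ofReal (16 * x 0 * (4 ^ K)⁻¹))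
    rw [add_zero] at h1
    exact ENNReal.Tendsto.const_mul h1 (Or.inr (by simp))

lemma measure_transversal_le (hW : IsWiener W) (x : E (d + 2)) (hx : 0 < x 0) {j : Fin (d + 2)}
    (hj : j ≠ 0) (hxj : x j = 0) (k : ℕ) {a : ℝ} (ha : 0 < a) :
    W x (positivePaths x ∩ {w | ∃ t ≤ mesh k, a < |w t j|})
      ≤ ENNReal.ofReal (2 * x 0) * ENNReal.ofReal (mesh k / a ^ 2) := by
  refine measure_le_of_eventually_mem (W x)
    (s := fun N => {w | gridIncrement (16 ^ N) (mesh N) 0 w ∈ surviveSet (16 ^ N) (x 0)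
      ∧ gridIncrement (16 ^ N) (mesh N) j w ∈ maxSet (16 ^ N) (16 ^ (N - k)) 0 a})
    (c := fun N => (ENNReal.ofReal (2 * x 0) + (16 ^ N : ℕ) * bigStep (mesh N) (x 0))
        * ENNReal.ofReal (mesh k / a ^ 2)) ?_ ?_ ?_
  · rintro w ⟨⟨hw0, hw⟩, t, ht, hta⟩
    filter_upwards [(tendsto_eval_gridIndex w t j).abs.eventually_const_lt hta,
      eventually_ge_atTop k] with N hN hkN
    have hle : gridIndex t N ≤ 16 ^ (N - k) := gridIndex_le_of_le_mul (by rwa [← mesh_eq hkN])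
    refine ⟨gridIncrement_mem_surviveSet hw (mesh_mul_pow N).le (by rw [hw0]),
      gridIndex t N, hle, ?_⟩
    rw [walk_gridIncrement, hw0, hxj, zero_add, sub_zero]
    · exact hN
    · exact hle.trans (Nat.pow_le_pow_right (by norm_num) (by omega))
  · filter_upwards [eventually_ge_atTop k] with N hkN
    rw [hW.measure_gridIncrement_inter x _ _ hj.symm (measurableSet_surviveSet _ _)
      (measurableSet_maxSet _ _ _ _)]
    refine mul_le_mul' ?_ ((stepLaw_maxSet_le _ ha _ _ _).trans (ENNReal.ofReal_le_ofReal ?_))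
    · have := surviveProb_mesh_le hx (Nat.zero_le N)
      rw [pow_zero, mul_one, Nat.sub_zero] at this
      exact this
    · have h : (((16 ^ (N - k) : ℕ) : ℝ) * (mesh N : ℝ)) = mesh k := by
        exact_mod_cast (mesh_eq hkN).symm
      rw [h]
      simp
  · have h1 := (tendsto_pow_mul_bigStep hx).const_add (ENNReal.ofReal (2 * x 0))
    rw [add_zero] at h1
    exact ENNReal.Tendsto.mul_const h1 (Or.inr ofReal_ne_top)

lemma le_measure_positive (hW : IsWiener W) (x : E (d + 2)) (hx : 0 < x 0) (hx' : x 0 ≤ 1) :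
    ENNReal.ofReal (gaussianPDFReal 0 2 1 * x 0) ≤ W x {w | ∀ t ≤ 2, 0 < w t 0} := by
  have := (hW x).1
  have hbad : W x {w | w 0 = x ∧ ∃ t ≤ 2, w t 0 < x 0 / 2}
      ≤ 1 - ENNReal.ofReal (gaussianPDFReal 0 2 1 * x 0) := by
    refine measure_le_of_eventually_mem (W x)
      (s := fun N => {w | gridIncrement (2 * 16 ^ N) (mesh N) 0 w
        ∈ (surviveSet (2 * 16 ^ N) (x 0 / 2))ᶜ})
      (c := fun _ => 1 - ENNReal.ofReal (gaussianPDFReal 0 2 1 * x 0)) ?_ ?_ tendsto_const_nhds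
    · rintro w ⟨hw0, t, ht, htx⟩
      filter_upwards [(tendsto_eval_gridIndex w t 0).eventually_lt_const htx] with N hN hmem
      have hle : gridIndex t N ≤ 2 * 16 ^ N := by
        refine gridIndex_le_of_le_mul ?_
        have := mesh_mul_pow N
        push_cast at this ⊢
        rwa [mul_assoc, this, mul_one]
      have := hmem _ hle
      rw [walk_gridIncrement _ _ _ _ hle, hw0] at this
      linarith
    · refine Eventually.of_forall fun N => ?_
      rw [hW.measure_gridIncrement x _ _ _ (measurableSet_surviveSet _ _).compl,
        prob_compl_eq_one_sub (measurableSet_surviveSet _ _)]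
      refine tsub_le_tsub_left ?_ _
      have h := le_surviveProb_two (mesh N) (2 * 16 ^ N) (by
        have := mesh_mul_pow N
        push_cast at this ⊢
        rw [mul_assoc, this, mul_one]) (half_pos hx) (by linarith)
      rwa [mul_div_cancel₀ _ two_ne_zero] at h
  have hcover : {w : PathSpace (d + 2) | w 0 = x} ⊆
      {w | ∀ t ≤ 2, 0 < w t 0} ∪ {w | w 0 = x ∧ ∃ t ≤ 2, w t 0 < x 0 / 2} := by
    intro w hw
    by_cases h : ∃ t ≤ 2, w t 0 < x 0 / 2
    · exact Or.inr ⟨hw, h⟩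
    · push Not at h
      exact Or.inl fun t ht => (half_pos hx).trans_le (h t ht)
  have h1 := (measure_mono hcover).trans (measure_union_le (μ := W x) _ _)
  rw [(hW x).2.1] at h1
  have hle1 : ENNReal.ofReal (gaussianPDFReal 0 2 1 * x 0) ≤ 1 := by
    have := le_surviveProb_two 2 1 (by simp) (half_pos hx) (by linarith)
    rw [mul_div_cancel₀ _ two_ne_zero] at this
    exact this.trans (surviveProb_le_one _ _ _)
  have h2 := h1.trans (add_le_add_right hbad _)
  have h3 : ENNReal.ofReal (gaussianPDFReal 0 2 1 * x 0)
      + (1 - ENNReal.ofReal (gaussianPDFReal 0 2 1 * x 0)) = 1 := add_tsub_cancel_of_le hle1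
  exact (ENNReal.add_le_add_iff_right (ENNReal.sub_ne_top one_ne_top)).1 (h3.le.trans h2)

lemma mem_of_lt_exitTime {d : ℕ} {U : Set (E d)} {w : PathSpace d} {t : ℝ≥0} (ht : 0 < t)
    (h : (t : ℝ≥0∞) < exitTime U w) : w t ∈ U := by
  by_contra hn
  exact (sInf_le ⟨t, ⟨ht, hn⟩, rfl⟩ : exitTime U w ≤ t).not_gt h

lemma exists_notMem_of_exitTime_lt {d : ℕ} {U : Set (E d)} {w : PathSpace d} {s : ℝ≥0}
    (h : exitTime U w < s) : ∃ t, 0 < t ∧ t < s ∧ w t ∉ U := by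
  obtain ⟨_, ⟨t, ht, rfl⟩, hts⟩ := sInf_lt_iff.1 h
  exact ⟨t, ht.1, by exact_mod_cast hts, ht.2⟩

lemma le_exitTime {d : ℕ} {U : Set (E d)} {w : PathSpace d} {s : ℝ≥0}
    (h : ∀ t, 0 < t → t < s → w t ∈ U) : (s : ℝ≥0∞) ≤ exitTime U w := by
  by_contra! hlt
  obtain ⟨t, ht, hts, htU⟩ := exists_notMem_of_exitTime_lt hlt
  exact htU (h t ht hts)

lemma exists_mesh_lt {ε : ℝ≥0} (hε : 0 < ε) : ∃ n, mesh n < ε := by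
  obtain ⟨n, hn⟩ := (tendsto_mesh.eventually_lt_const (NNReal.coe_pos.2 hε)).exists
  exact ⟨n, by exact_mod_cast hn⟩

lemma measurableSet_one_lt_exitTime {d : ℕ} {U : Set (E d)} (hU : IsOpen U) :
    MeasurableSet {w : PathSpace d | 1 < exitTime U w} := by
  have h : {w : PathSpace d | 1 < exitTime U w}
      = ⋃ n, ⋂ m, {w : PathSpace d | Set.MapsTo w (Set.Icc (mesh m) (1 + mesh n)) U} := by
    ext w
    simp only [Set.mem_ofPred_eq, Set.mem_iUnion, Set.mem_iInter]
    constructor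
    · intro hw
      obtain ⟨r, hr1, hr⟩ := ENNReal.lt_iff_exists_nnreal_btwn.1 hw
      have hr1 : 1 < r := by exact_mod_cast hr1
      obtain ⟨n, hn⟩ := exists_mesh_lt (tsub_pos_of_lt hr1)
      refine ⟨n, fun m t ht => ?_⟩
      refine mem_of_lt_exitTime ((pos_iff_ne_zero.2 (mesh_ne_zero m)).trans_le ht.1) ?_
      refine lt_of_le_of_lt ?_ hr
      have := ht.2.trans (lt_tsub_iff_left.1 hn).le
      exact_mod_cast this
    · rintro ⟨n, hn⟩
      have h1 : ((1 + mesh n : ℝ≥0) : ℝ≥0∞) ≤ exitTime U w := by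
        refine le_exitTime fun t ht hts => ?_
        obtain ⟨m, hm⟩ := exists_mesh_lt ht
        exact hn m ⟨hm.le, hts.le⟩
      refine lt_of_lt_of_le ?_ h1
      have : 1 < 1 + mesh n := lt_add_of_pos_right _ (pos_iff_ne_zero.2 (mesh_ne_zero n))
      exact_mod_cast this
  rw [h]
  exact MeasurableSet.iUnion fun n => MeasurableSet.iInter fun m =>
    (ContinuousMap.isOpen_setOfPred_mapsTo isCompact_Icc hU).measurableSet

lemma le_sum_sq_of_notMem_ball {y : E (d + 2)} (hy : 0 < y 0) (hy1 : y 0 ≤ 1)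
    (hyB : y ∉ Metric.ball (EuclideanSpace.single (0 : Fin (d + 2)) (1 : ℝ)) 1) :
    y 0 ≤ ∑ i : Fin (d + 1), y i.succ ^ 2 := by
  rw [Metric.mem_ball, not_lt, dist_eq_norm] at hyB
  have h : (1 : ℝ) ≤ ‖y - EuclideanSpace.single (0 : Fin (d + 2)) (1 : ℝ)‖ ^ 2 := by nlinarith
  rw [EuclideanSpace.norm_sq_eq, Fin.sum_univ_succ] at h
  simp only [PiLp.sub_apply, PiLp.single_apply, Fin.succ_ne_zero, if_true, if_false,
    sub_zero, Real.norm_eq_abs, sq_abs] at h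
  nlinarith

/-- A path started at `x` that stays in the half-space but leaves the unit ball centered at `e₁`
early moves far in the first direction or, at some scale `k ≥ K`, is too low or moves far in one
of the other directions. -/
lemma exit_ball_subset (x : E (d + 2)) (hx : 0 < x 0) {K : ℕ} {s : ℝ≥0} (hs : 0 < s)
    (hsK : 2 * s ≤ mesh K) :
    {w : PathSpace (d + 2) | w 0 = x} ∩ ({w | 1 < exitTime {x : E (d + 2) | 0 < x 0} w} ∩
      {w | exitTime (Metric.ball (EuclideanSpace.single (0 : Fin (d + 2)) (1 : ℝ)) 1) w ≤ s})
    ⊆ (positivePaths x ∩ {w | ∃ t ≤ mesh K, 1 < w t 0}) ∪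
      ⋃ n : ℕ, ((positivePaths x ∩ {w | ∃ t, mesh (K + n + 1) ≤ t ∧ t ≤ mesh (K + n) ∧
          w t 0 < (8 ^ (K + n))⁻¹}) ∪
        ⋃ i : Fin (d + 1), (positivePaths x ∩ {w | ∃ t ≤ mesh (K + n),
          Real.sqrt ((8 ^ (K + n))⁻¹ / (d + 2)) < |w t i.succ|})) := by
  rintro w ⟨hw0, hwD, hwB⟩
  have hpos : w ∈ positivePaths x := by
    refine ⟨hw0, fun t ht => ?_⟩
    rcases eq_or_ne t 0 with rfl | ht0
    · rw [hw0]; exact hx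
    · refine mem_of_lt_exitTime (pos_iff_ne_zero.2 ht0) (lt_of_le_of_lt ?_ hwD)
      exact_mod_cast ht
  obtain ⟨t, ht0, hts, htB⟩ := exists_notMem_of_exitTime_lt (s := 2 * s)
    (lt_of_le_of_lt hwB (by
      have : s < 2 * s := lt_mul_of_one_lt_left hs one_lt_two
      exact_mod_cast this))
  have htK : t ≤ mesh K := hts.le.trans hsK
  have hmesh1 : ∀ k, mesh k ≤ 1 := fun k => inv_le_one_of_one_le₀ (one_le_pow₀ (by norm_num))
  have hwt : 0 < w t 0 := hpos.2 t (htK.trans (hmesh1 K))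
  rcases lt_or_ge 1 (w t 0) with h1 | h1
  · exact Or.inl ⟨hpos, t, htK, h1⟩
  right
  have hsum := le_sum_sq_of_notMem_ball hwt h1 htB
  obtain ⟨k, hk1, hk2⟩ := exists_nat_pow_near_of_lt_one ht0 (htK.trans (hmesh1 K))
    (show (0 : ℝ≥0) < 16⁻¹ by positivity) (inv_lt_one_of_one_lt₀ (by norm_num))
  rw [inv_pow] at hk1 hk2
  have hKk : K ≤ k := by
    by_contra! hlt
    have h2 : mesh K ≤ mesh (k + 1) := by
      unfold mesh
      gcongr
      · norm_num
      · omega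
    exact (hk1.trans_le (htK.trans h2)).false
  obtain ⟨n, rfl⟩ := Nat.exists_eq_add_of_le hKk
  refine Set.mem_iUnion.2 ⟨n, ?_⟩
  rcases lt_or_ge (w t 0) (8 ^ (K + n))⁻¹ with h2 | h2
  · exact Or.inl ⟨hpos, t, hk1.le, hk2, h2⟩
  right
  have hb : (0 : ℝ) < (8 ^ (K + n))⁻¹ := by positivity
  set b : ℝ := (8 ^ (K + n))⁻¹
  obtain ⟨i, hi⟩ : ∃ i : Fin (d + 1), b / (d + 2) < w t i.succ ^ 2 := by
    by_contra! h
    have h3 := Finset.sum_le_sum fun i (_ : i ∈ Finset.univ) => h i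
    rw [Finset.sum_const, Finset.card_univ, Fintype.card_fin, nsmul_eq_mul] at h3
    have h4 : ((d + 1 : ℕ) : ℝ) * (b / (d + 2)) < b := by
      rw [← mul_div_assoc, div_lt_iff₀ (by positivity)]
      push_cast
      nlinarith
    linarith
  refine Set.mem_iUnion.2 ⟨i, hpos, t, hk2, ?_⟩
  rw [Real.sqrt_lt' (abs_pos.2 ?_), sq_abs]
  · exact hi
  · rintro h
    rw [h] at hi
    have : 0 < b / (d + 2) := by positivity
    norm_num at hi
    linarith

lemma measure_exit_ball_le (hW : IsWiener W) (x : E (d + 2)) (hx : 0 < x 0) (hx' : x 0 ≤ 1 / 4)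
    (hxj : ∀ i : Fin (d + 1), x i.succ = 0) {K : ℕ} (hK : 1 ≤ K) {s : ℝ≥0} (hs : 0 < s)
    (hsK : 2 * s ≤ mesh K) :
    W x ({w | 1 < exitTime {x : E (d + 2) | 0 < x 0} w} ∩
      {w | exitTime (Metric.ball (EuclideanSpace.single (0 : Fin (d + 2)) (1 : ℝ)) 1) w ≤ s})
    ≤ ENNReal.ofReal ((128 + 4 * (d + 1) * (d + 2)) * x 0 * (2 ^ K)⁻¹) := by
  have := (hW x).1
  set A : Set (PathSpace (d + 2)) := {w | 1 < exitTime {x : E (d + 2) | 0 < x 0} w} ∩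
    {w | exitTime (Metric.ball (EuclideanSpace.single (0 : Fin (d + 2)) (1 : ℝ)) 1) w ≤ s}
  have hstart : W x {w | w 0 = x}ᶜ = 0 := by
    rw [prob_compl_eq_zero_iff]
    · exact (hW x).2.1
    · exact (isClosed_eq (continuous_eval_const 0) continuous_const).measurableSet
  have hA : W x A ≤ W x ({w | w 0 = x} ∩ A) := by
    refine (measure_mono (t := ({w | w 0 = x} ∩ A) ∪ {w | w 0 = x}ᶜ) fun w hw => ?_).trans
      ((measure_union_le _ _).trans_eq (by rw [hstart, add_zero]))
    by_cases h : w 0 = x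
    · exact Or.inl ⟨h, hw⟩
    · exact Or.inr h
  refine hA.trans ((measure_mono (exit_ball_subset x hx hs hsK)).trans
    ((measure_union_le _ _).trans ?_))
  set q : ℝ := x 0 * (2 ^ K)⁻¹ with hq
  have hq0 : 0 ≤ q := by positivity
  have hfirst : W x (positivePaths x ∩ {w | ∃ t ≤ mesh K, 1 < w t 0}) ≤ ENNReal.ofReal (64 * q) := by
    refine (measure_exceed_le hW x hx hx' K).trans ?_
    rw [← ENNReal.ofReal_ofNat 4, ← ENNReal.ofReal_mul (by norm_num)]
    refine ENNReal.ofReal_le_ofReal ?_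
    have : ((4 : ℝ) ^ K)⁻¹ ≤ (2 ^ K)⁻¹ := by
      gcongr
      norm_num
    rw [hq]
    nlinarith [mul_le_mul_of_nonneg_left this hx.le]
  have hscale : ∀ n : ℕ, W x ((positivePaths x ∩ {w | ∃ t, mesh (K + n + 1) ≤ t ∧
          t ≤ mesh (K + n) ∧ w t 0 < (8 ^ (K + n))⁻¹}) ∪
        ⋃ i : Fin (d + 1), (positivePaths x ∩ {w | ∃ t ≤ mesh (K + n),
          Real.sqrt ((8 ^ (K + n))⁻¹ / (d + 2)) < |w t i.succ|}))
      ≤ ENNReal.ofReal ((32 + 2 * (d + 1) * (d + 2)) * q) * 2⁻¹ ^ n := by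
    intro n
    have hlow := measure_low_le hW x hx (k := K + n) (by omega)
      (show (0 : ℝ) < (8 ^ (K + n))⁻¹ by positivity)
    have hside : ∀ i : Fin (d + 1), W x (positivePaths x ∩ {w | ∃ t ≤ mesh (K + n),
          Real.sqrt ((8 ^ (K + n))⁻¹ / (d + 2)) < |w t i.succ|})
        ≤ ENNReal.ofReal (2 * (d + 2) * q * 2⁻¹ ^ n) := by
      intro i
      refine (measure_transversal_le hW x hx i.succ_ne_zero (hxj i) (K + n)
        (Real.sqrt_pos.2 (by positivity))).trans_eq ?_
      rw [Real.sq_sqrt (by positivity), ← ENNReal.ofReal_mul (by positivity)]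
      congr 1
      have h16 : (16 : ℝ) ^ (K + n) = 2 ^ K * 2 ^ n * 8 ^ (K + n) := by
        rw [← pow_add, ← mul_pow]
        norm_num
      simp only [mesh, hq]
      push_cast
      rw [h16, inv_pow]
      field_simp
    calc _ ≤ ENNReal.ofReal (32 * q * 2⁻¹ ^ n)
          + ∑ _i : Fin (d + 1), ENNReal.ofReal (2 * (d + 2) * q * 2⁻¹ ^ n) := by
          refine (measure_union_le _ _).trans (add_le_add (hlow.trans_eq ?_)
            ((measure_iUnion_fintype_le _ _).trans (Finset.sum_le_sum fun i _ => hside i)))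
          rw [← ENNReal.ofReal_mul (by positivity)]
          congr 1
          have h8 : (8 : ℝ) ^ (K + n) = 2 ^ K * 2 ^ n * 4 ^ (K + n) := by
            rw [← pow_add, ← mul_pow]
            norm_num
          rw [h8, hq, pow_succ, inv_pow]
          field_simp
          norm_num
      _ = _ := by
          rw [Finset.sum_const, Finset.card_univ, Fintype.card_fin, nsmul_eq_mul,
            ← ENNReal.ofReal_natCast, ← ENNReal.ofReal_mul (by positivity),
            ← ENNReal.ofReal_add (by positivity) (by positivity),
            show (2⁻¹ : ℝ≥0∞) = ENNReal.ofReal 2⁻¹ by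
              rw [ENNReal.ofReal_inv_of_pos two_pos, ENNReal.ofReal_ofNat],
            ← ENNReal.ofReal_pow (by positivity), ← ENNReal.ofReal_mul (by positivity)]
          congr 1
          push_cast
          ring
  calc _ ≤ ENNReal.ofReal (64 * q)
        + ∑' n : ℕ, ENNReal.ofReal ((32 + 2 * (d + 1) * (d + 2)) * q) * 2⁻¹ ^ n :=
        add_le_add hfirst ((measure_iUnion_le _).trans (ENNReal.tsum_le_tsum hscale))
    _ = _ := by
        rw [ENNReal.tsum_mul_left, ENNReal.tsum_geometric, ENNReal.one_sub_inv_two, inv_inv, mul_two,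
          ← ENNReal.ofReal_add (by positivity) (by positivity),
          ← ENNReal.ofReal_add (by positivity) (by positivity)]
        congr 1
        rw [hq]
        ring

lemma le_measure_one_lt_exitTime (hW : IsWiener W) (x : E (d + 2)) (hx : 0 < x 0)
    (hx' : x 0 ≤ 1) :
    ENNReal.ofReal (gaussianPDFReal 0 2 1 * x 0)
      ≤ W x {w | 1 < exitTime {x : E (d + 2) | 0 < x 0} w} := by
  refine (le_measure_positive hW x hx hx').trans (measure_mono fun w hw => ?_)
  refine lt_of_lt_of_le ?_ (le_exitTime (s := 2) fun t _ ht => hw t ht.le)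
  norm_num

lemma condLaw_exit_ball_le (hW : IsWiener W) {l : ℝ} (hl : 0 < l) (hl' : l ≤ 1 / 4) {K : ℕ}
    (hK : 1 ≤ K) {s : ℝ≥0} (hs : 0 < s) (hsK : 2 * s ≤ mesh K) :
    condLaw W {x : E (d + 2) | 0 < x 0}
        (l • EuclideanSpace.single (0 : Fin (d + 2)) (1 : ℝ))
        {w | exitTime (Metric.ball (EuclideanSpace.single (0 : Fin (d + 2)) (1 : ℝ)) 1) w
          ≤ (s : ℝ≥0∞)}
      ≤ ENNReal.ofReal ((128 + 4 * (d + 1) * (d + 2)) / gaussianPDFReal 0 2 1 * (2 ^ K)⁻¹) := by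
  have hc : 0 < gaussianPDFReal 0 2 1 := gaussianPDFReal_pos _ _ _ two_ne_zero
  have h0 : (l • EuclideanSpace.single (0 : Fin (d + 2)) (1 : ℝ)) 0 = l := by simp
  have hopen : IsOpen {x : E (d + 2) | 0 < x 0} :=
    isOpen_lt continuous_const
      (EuclideanSpace.proj (0 : Fin (d + 2)) : E (d + 2) →L[ℝ] ℝ).continuous
  rw [condLaw, cond_apply (measurableSet_one_lt_exitTime hopen)]
  have h1 := le_measure_one_lt_exitTime hW (l • EuclideanSpace.single (0 : Fin (d + 2)) (1 : ℝ))
    (by rwa [h0]) (by rw [h0]; linarith)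
  have h2 := measure_exit_ball_le hW (l • EuclideanSpace.single (0 : Fin (d + 2)) (1 : ℝ))
    (by rwa [h0]) (by rwa [h0]) (fun i => by simp) hK hs hsK
  rw [h0] at h1 h2
  refine (mul_le_mul' (ENNReal.inv_le_inv.2 h1) h2).trans_eq ?_
  rw [← ENNReal.ofReal_inv_of_pos (by positivity), ← ENNReal.ofReal_mul (by positivity)]
  congr 1
  field_simp

end Paths

/-- **The ball estimate** (Lemma 4.3): let `d ≥ 2`, `D = {x : x₁ > 0}` and `B` the open
unit ball centered at `e₁`. Then
`lim_{s → 0⁺} limsup_{λ → 0⁺} W̃^D_{λe₁,1}(τ_B ≤ s) = 0`. -/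
theorem ball_estimate (d : ℕ)
    (W : E (d + 2) → Measure (PathSpace (d + 2))) (hW : IsWiener W) :
    Tendsto
      (fun s : ℝ≥0 =>
        Filter.limsup
          (fun lam : ℝ =>
            condLaw W {x : E (d + 2) | 0 < x 0}
              (lam • EuclideanSpace.single (0 : Fin (d + 2)) (1 : ℝ))
              {w | exitTime
                  (Metric.ball (EuclideanSpace.single (0 : Fin (d + 2)) (1 : ℝ)) 1) w
                ≤ (s : ℝ≥0∞)})
          (𝓝[>] (0 : ℝ)))
      (𝓝[>] (0 : ℝ≥0)) (𝓝 (0 : ℝ≥0∞)) := by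
  rw [ENNReal.tendsto_nhds_zero]
  intro ε hε
  have hlim : Tendsto (fun K : ℕ => ENNReal.ofReal
      ((128 + 4 * (d + 1) * (d + 2)) / gaussianPDFReal 0 2 1 * (2 ^ K)⁻¹)) atTop (𝓝 0) := by
    rw [← ENNReal.ofReal_zero]
    refine ENNReal.tendsto_ofReal ?_
    have h := (_root_.tendsto_pow_atTop_nhds_zero_of_lt_one (r := (2 : ℝ)⁻¹) (by norm_num)
      (by norm_num)).const_mul ((128 + 4 * (d + 1) * (d + 2)) / gaussianPDFReal 0 2 1)
    rw [mul_zero] at h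
    simpa only [inv_pow] using h
  obtain ⟨K, hKε, hK⟩ := ((hlim.eventually_lt_const hε).and (eventually_ge_atTop 1)).exists
  have hmesh : 0 < mesh K / 2 := half_pos (pos_iff_ne_zero.2 (mesh_ne_zero K))
  filter_upwards [Ioo_mem_nhdsGT hmesh] with s hs
  refine le_trans (limsup_le_of_le isCobounded_le_of_bot ?_) hKε.le
  filter_upwards [Ioc_mem_nhdsGT (show (0 : ℝ) < 1 / 4 by norm_num)] with l hl
  refine condLaw_exit_ball_le hW hl.1 hl.2 hK hs.1 ?_
  have := (lt_div_iff₀ two_pos).1 hs.2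
  rw [mul_comm]
  exact this.le

end
end
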